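/- (Right derivative at the optimal boundary.) Let K > 0 and assume either r > 0, or r = 0 and ℙ(lim_{t → ∞} X_t = ∞) = 1. Let v(x) = sup_{τ} E[e^{−r τ} (K − e^{x + X_τ})^+ 1_{{τ < ∞}}] (supremum over all stopping times) and x* = log(K E[e^{X̲_{e_r}}]). Then the right derivative of v at x* exists and equals v'(x*+) = −e^{x*} + K ℙ(X̲_{e_r} = 0), where for r > 0 one has ℙ(X̲_{e_r} = 0) = ∫_0^∞ r e^{−r t} ℙ(X̲_t = 0) dt and for r = 0 it is ℙ(X̲_∞ = 0). -/

import Mathlib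

open MeasureTheory ProbabilityTheory Set Filter
open scoped ENNReal NNReal Classical

noncomputable section

namespace AKLevy

variable {Ω : Type*}

/-- Running supremum `X̄_t = sup_{0 ≤ s ≤ t} X_s` of a process. -/
def runSup (X : ℝ → Ω → ℝ) (t : ℝ) (ω : Ω) : ℝ :=
  sSup ((fun s => X s ω) '' Set.Icc 0 t)

/-- Running infimum `X̲_t = inf_{0 ≤ s ≤ t} X_s` of a process. -/
def runInf (X : ℝ → Ω → ℝ) (t : ℝ) (ω : Ω) : ℝ :=
  sInf ((fun s => X s ω) '' Set.Icc 0 t)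

/-- All-time supremum `X̄_∞ = sup_{t ≥ 0} X_t`. -/
def supAll (X : ℝ → Ω → ℝ) (ω : Ω) : ℝ :=
  sSup ((fun s => X s ω) '' Set.Ici 0)

/-- All-time infimum `X̲_∞ = inf_{t ≥ 0} X_t`. -/
def infAll (X : ℝ → Ω → ℝ) (ω : Ω) : ℝ :=
  sInf ((fun s => X s ω) '' Set.Ici 0)

/-- `X` is a real-valued Lévy process with respect to the filtration `ℱ`,
on a filtered probability space satisfying the usual conditions. -/
structure IsLevy [m0 : MeasurableSpace Ω] (P : Measure Ω) (ℱ : Filtration ℝ m0)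
    (X : ℝ → Ω → ℝ) : Prop where
  isProb : IsProbabilityMeasure P
  adapted : ∀ t : ℝ, 0 ≤ t → StronglyMeasurable[ℱ t] (X t)
  zero : ∀ᵐ ω ∂P, X 0 ω = 0
  rightCont : ∀ ω, ∀ t : ℝ, 0 ≤ t → ContinuousWithinAt (fun s => X s ω) (Set.Ici t) t
  leftLim : ∀ ω, ∀ t : ℝ, 0 < t →
    ∃ l : ℝ, Tendsto (fun s => X s ω) (nhdsWithin t (Set.Iio t)) (nhds l)
  indepIncrements : ∀ s t : ℝ, 0 ≤ s → s ≤ t →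
    Indep (MeasurableSpace.comap (fun ω => X t ω - X s ω) inferInstance) (ℱ s) P
  stationary : ∀ s t : ℝ, 0 ≤ s → s ≤ t →
    Measure.map (fun ω => X t ω - X s ω) P = Measure.map (X (t - s)) P
  filtRightCont : ∀ t : ℝ, (ℱ t : MeasurableSpace Ω) = ⨅ s ∈ Set.Ioi t, (ℱ s : MeasurableSpace Ω)
  complete : ∀ N : Set Ω, MeasurableSet N → P N = 0 → MeasurableSet[ℱ 0] N

/-- `τ_x^+ < ∞`: the process passes strictly above level `x` at some nonnegative time. -/
def hitsAbove (X : ℝ → Ω → ℝ) (x : ℝ) (ω : Ω) : Prop := ∃ t, 0 ≤ t ∧ x < X t ω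

/-- First passage time above `x`:  `τ_x^+ = inf {t ≥ 0 : X_t > x}` (junk value if never). -/
def tauAbove (X : ℝ → Ω → ℝ) (x : ℝ) (ω : Ω) : ℝ := sInf {t : ℝ | 0 ≤ t ∧ x < X t ω}

/-- `τ_x^- < ∞`: the process passes strictly below level `x` at some nonnegative time. -/
def hitsBelow (X : ℝ → Ω → ℝ) (x : ℝ) (ω : Ω) : Prop := ∃ t, 0 ≤ t ∧ X t ω < x

/-- First passage time below `x`:  `τ_x^- = inf {t ≥ 0 : X_t < x}` (junk value if never). -/
def tauBelow (X : ℝ → Ω → ℝ) (x : ℝ) (ω : Ω) : ℝ := sInf {t : ℝ | 0 ≤ t ∧ X t ω < x}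

/-- The `[0,∞]`-valued first passage time `σ_x = inf { t ≥ 0 : x + X_t < y }`, with `inf ∅ = ∞`. -/
def hitBelowE (X : ℝ → Ω → ℝ) (y x : ℝ) (ω : Ω) : ℝ≥0∞ :=
  if ∃ t, 0 ≤ t ∧ x + X t ω < y then ENNReal.ofReal (sInf {t : ℝ | 0 ≤ t ∧ x + X t ω < y})
  else ∞

/-- The stopped clock `t ∧ σ_x` (real-valued), where `σ_x = inf{ t ≥ 0 : x + X_t < y}`. -/
def stoppedClock (X : ℝ → Ω → ℝ) (y x : ℝ) (t : ℝ) (ω : Ω) : ℝ :=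
  (min (ENNReal.ofReal t) (hitBelowE X y x ω)).toReal

/-- A `[0,∞]`-valued stopping time of the filtration `ℱ`. -/
def IsStopTime [m0 : MeasurableSpace Ω] (ℱ : Filtration ℝ m0) (τ : Ω → ℝ≥0∞) : Prop :=
  ∀ t : ℝ, 0 ≤ t → MeasurableSet[ℱ t] {ω | τ ω ≤ ENNReal.ofReal t}

/-- Discounted payoff `e^{-rτ} G(x + X_τ)` at a `[0,∞]`-valued time `τ`, set to `0` on `{τ = ∞}`. -/
def stopPayoff (X : ℝ → Ω → ℝ) (r x : ℝ) (G : ℝ → ℝ) (τ : Ω → ℝ≥0∞) (ω : Ω) : ℝ :=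
  if τ ω ≠ ∞ then Real.exp (-(r * (τ ω).toReal)) * G (x + X ((τ ω).toReal) ω) else 0

/-- Discounted American put payoff `e^{-rτ}(K - e^{x + X_τ})^+ 1_{τ < ∞}`. -/
def putPayoff (X : ℝ → Ω → ℝ) (r K x : ℝ) (τ : Ω → ℝ≥0∞) (ω : Ω) : ℝ :=
  stopPayoff X r x (fun z => max (K - Real.exp z) 0) τ ω

/-- Value function `v(x) = sup_τ E[e^{-rτ}(K - e^{x+X_τ})^+ 1_{τ<∞}]`, the supremum
being over all `[0,∞]`-valued stopping times of `ℱ`. -/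
def putValue [m0 : MeasurableSpace Ω] (P : Measure Ω) (ℱ : Filtration ℝ m0)
    (X : ℝ → Ω → ℝ) (r K x : ℝ) : ℝ :=
  ⨆ τ : {τ : Ω → ℝ≥0∞ // IsStopTime ℱ τ}, ∫ ω, putPayoff X r K x τ.1 ω ∂P

/-- `m = E[e^{X̲_{e_r}}]`, where `e_r` is an independent exponential time of rate `r > 0`,
and `e_0 = ∞`. -/
def mInf [m0 : MeasurableSpace Ω] (P : Measure Ω) (X : ℝ → Ω → ℝ) (r : ℝ) : ℝ :=
  if 0 < r then
    ∫ t in Set.Ioi (0 : ℝ), r * Real.exp (-(r * t)) * (∫ ω, Real.exp (runInf X t ω) ∂P)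
  else ∫ ω, Real.exp (infAll X ω) ∂P

/-- `P(X̲_{e_r} = 0)`, where `e_r` is an independent exponential time of rate `r > 0`,
and `e_0 = ∞`. -/
def atomZeroProb [m0 : MeasurableSpace Ω] (P : Measure Ω) (X : ℝ → Ω → ℝ) (r : ℝ) : ℝ :=
  if 0 < r then
    ∫ t in Set.Ioi (0 : ℝ), r * Real.exp (-(r * t)) * (P {ω | runInf X t ω = 0}).toReal
  else (P {ω | infAll X ω = 0}).toReal

/-- The event `{τ_0^- = 0}`: `0` is (pathwise) immediately reached from below, i.e.
`inf{t ≥ 0 : X_t < 0} = 0`. -/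
def regularBelow (X : ℝ → Ω → ℝ) : Set Ω :=
  {ω | ∀ ε > (0 : ℝ), ∃ t, 0 ≤ t ∧ t < ε ∧ X t ω < 0}

/-- `E[e^{-γ X̄_{e_α}}] = ∫_0^∞ α e^{-α t} E[e^{-γ X̄_t}] dt`. -/
def expSupLT [m0 : MeasurableSpace Ω] (P : Measure Ω) (X : ℝ → Ω → ℝ) (α γ : ℝ) : ℝ :=
  ∫ t in Set.Ioi (0 : ℝ), α * Real.exp (-(α * t)) * (∫ ω, Real.exp (-(γ * runSup X t ω)) ∂P)

/-- The function `h_{α,β}(x) = E[e^{-α σ_x + β (x + X_{σ_x})} 1_{σ_x < ∞}]`, where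
`σ_x = inf{t ≥ 0 : x + X_t < 0}`. -/
def hAB [m0 : MeasurableSpace Ω] (P : Measure Ω) (X : ℝ → Ω → ℝ) (α β : ℝ) (z : ℝ) : ℝ :=
  ∫ ω, (if hitsBelow X (-z) ω then
      Real.exp (-(α * tauBelow X (-z) ω) + β * (z + X (tauBelow X (-z) ω) ω)) else 0) ∂P

/-- `v_y(x) = E[e^{-r σ_x} (K - e^{x + X_{σ_x}})^+ 1_{σ_x<∞}]` where
`σ_x = inf{t ≥ 0 : x + X_t < y}`. -/
def vy [m0 : MeasurableSpace Ω] (P : Measure Ω) (X : ℝ → Ω → ℝ) (r K y : ℝ) (z : ℝ) : ℝ :=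
  ∫ ω, putPayoff X r K z (hitBelowE X y z) ω ∂P

/-- The process `f` (indexed by `t ≥ 0`) is a martingale with respect to `ℱ` and `P`. -/
def MartOn [m0 : MeasurableSpace Ω] (P : Measure Ω) (ℱ : Filtration ℝ m0)
    (f : ℝ → Ω → ℝ) : Prop :=
  (∀ t : ℝ, 0 ≤ t → StronglyMeasurable[ℱ t] (f t)) ∧
  (∀ t : ℝ, 0 ≤ t → Integrable (f t) P) ∧
  ∀ s t : ℝ, 0 ≤ s → s ≤ t → P[f t|ℱ s] =ᵐ[P] f s

/-- The process `f` (indexed by `t ≥ 0`) is a supermartingale w.r.t. `ℱ` and `P`. -/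
def SupermartOn [m0 : MeasurableSpace Ω] (P : Measure Ω) (ℱ : Filtration ℝ m0)
    (f : ℝ → Ω → ℝ) : Prop :=
  (∀ t : ℝ, 0 ≤ t → StronglyMeasurable[ℱ t] (f t)) ∧
  (∀ t : ℝ, 0 ≤ t → Integrable (f t) P) ∧
  ∀ s t : ℝ, 0 ≤ s → s ≤ t → P[f t|ℱ s] ≤ᵐ[P] f s

/-- The exponential `e^{X_u}` of the process, as an extended nonnegative real. -/
def expX (X : ℝ → Ω → ℝ) (u : ℝ) (ω : Ω) : ℝ≥0∞ := ENNReal.ofReal (Real.exp (X u ω))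

/-- The infimum of `e^X` over the half-open time interval `[t, t + s)`. -/
def expInf (X : ℝ → Ω → ℝ) (t : ℝ) (s : ℝ≥0∞) (ω : Ω) : ℝ≥0∞ :=
  ⨅ u : ℝ, ⨅ _ : 0 ≤ u, ⨅ _ : ENNReal.ofReal u < s, expX X (t + u) ω

/-- The infimum of `e^X` over those of the times `t, t + h, …, t + k h` that precede `t + s`. -/
def gridInf (X : ℝ → Ω → ℝ) (h : ℝ) (k : ℕ) (t : ℝ) (s : ℝ≥0∞) (ω : Ω) : ℝ≥0∞ :=
  ⨅ j : ℕ, ⨅ _ : j ≤ k, ⨅ _ : ENNReal.ofReal (j * h) < s, expX X (t + j * h) ω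

/-- The counterpart of `gridInf` for the increments `X_{t + u} - X_t`. -/
def gridInfIncr (X : ℝ → Ω → ℝ) (h : ℝ) (k : ℕ) (t : ℝ) (s : ℝ≥0∞) (ω : Ω) : ℝ≥0∞ :=
  ⨅ j : ℕ, ⨅ _ : j ≤ k, ⨅ _ : ENNReal.ofReal (j * h) < s,
    ENNReal.ofReal (Real.exp (X (t + j * h) ω - X t ω))

lemma expX_ne_zero (X : ℝ → Ω → ℝ) (u : ℝ) (ω : Ω) : expX X u ω ≠ 0 := by
  simp [expX, Real.exp_pos]

lemma expX_ne_top (X : ℝ → Ω → ℝ) (u : ℝ) (ω : Ω) : expX X u ω ≠ ∞ := ENNReal.ofReal_ne_top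

lemma mul_iInf_prop {c : ℝ≥0∞} (h0 : c ≠ 0) (p : Prop) (f : p → ℝ≥0∞) :
    c * ⨅ h : p, f h = ⨅ h : p, c * f h := by
  by_cases hp : p <;> simp [hp, ENNReal.mul_top h0]

lemma gridInf_eq (X : ℝ → Ω → ℝ) (h : ℝ) (k : ℕ) (t : ℝ) (s : ℝ≥0∞) (ω : Ω) :
    gridInf X h k t s ω = expX X t ω * gridInfIncr X h k t s ω := by
  have h0 := expX_ne_zero X t ω
  unfold gridInf gridInfIncr
  rw [ENNReal.mul_iInf_of_ne h0 (expX_ne_top X t ω)]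
  simp only [mul_iInf_prop h0]
  refine iInf_congr fun j => iInf_congr fun _ => iInf_congr fun _ => ?_
  rw [expX, expX, ← ENNReal.ofReal_mul (Real.exp_pos _).le, ← Real.exp_add]
  ring_nf

lemma gridInfIncr_succ (X : ℝ → Ω → ℝ) (h : ℝ) (k : ℕ) (t : ℝ) (s : ℝ≥0∞) (ω : Ω) :
    gridInfIncr X h (k + 1) t s ω = min (gridInfIncr X h k t s ω)
      (⨅ _ : ENNReal.ofReal ((k + 1 : ℕ) * h) < s,
        ENNReal.ofReal (Real.exp (X (t + (k + 1 : ℕ) * h) ω - X t ω))) := by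
  unfold gridInfIncr
  apply le_antisymm
  · refine le_min ?_ ?_
    · exact le_iInf fun j => le_iInf fun hj => iInf₂_le j (by omega)
    · exact iInf_le_of_le (k + 1) (iInf_le_of_le le_rfl le_rfl)
  · refine le_iInf fun j => le_iInf fun hj => ?_
    rcases Nat.lt_or_ge k j with h1 | h1
    · obtain rfl : j = k + 1 := by omega
      exact min_le_right _ _
    · exact (min_le_left _ _).trans (iInf₂_le j h1)

section Levy

variable [m0 : MeasurableSpace Ω] {P : Measure Ω} {ℱ : Filtration ℝ m0} {X : ℝ → Ω → ℝ}

lemma IsLevy.measurable_of_le (hX : IsLevy P ℱ X) {u t : ℝ} (hu : 0 ≤ u) (hut : u ≤ t) :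
    Measurable[ℱ t] (X u) :=
  (hX.adapted u hu).measurable.mono (ℱ.mono hut) le_rfl

lemma IsLevy.measurable (hX : IsLevy P ℱ X) {u : ℝ} (hu : 0 ≤ u) : Measurable (X u) :=
  (hX.adapted u hu).measurable.mono (ℱ.le u) le_rfl

lemma IsLevy.measurable_expX (hX : IsLevy P ℱ X) {u : ℝ} (hu : 0 ≤ u) :
    Measurable[ℱ u] (expX X u) :=
  ENNReal.measurable_ofReal.comp (Real.measurable_exp.comp (hX.measurable_of_le hu le_rfl))

lemma IsLevy.measurable_gridInfIncr (hX : IsLevy P ℱ X) {h : ℝ} (hh : 0 ≤ h) (k : ℕ)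
    {t : ℝ} (ht : 0 ≤ t) (s : ℝ≥0∞) :
    Measurable[ℱ (t + k * h)] (gridInfIncr X h k t s) := by
  unfold gridInfIncr
  refine Measurable.iInf fun j => Measurable.iInf fun hj => Measurable.iInf fun _ => ?_
  have hj' : (j : ℝ) * h ≤ k * h := by gcongr
  have h0 : 0 ≤ (j : ℝ) * h := by positivity
  exact ENNReal.measurable_ofReal.comp (Real.measurable_exp.comp
    ((hX.measurable_of_le (by linarith) (by linarith)).sub
      (hX.measurable_of_le ht (by linarith))))

/-- The increments of the process after time `t` along a grid, together with their running
infimum, are independent of `ℱ t`, with a law that does not depend on `t`. -/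
lemma IsLevy.exists_map_eq_prod (hX : IsLevy P ℱ X) {β : Type*} [MeasurableSpace β] {h : ℝ}
    (hh : 0 ≤ h) (s : ℝ≥0∞) (k : ℕ) :
    ∃ μ : Measure (ℝ × ℝ≥0∞), IsProbabilityMeasure μ ∧
      ∀ t : ℝ, 0 ≤ t → ∀ Z : Ω → β, Measurable[ℱ t] Z →
        P.map (fun ω => (Z ω, (X (t + k * h) ω - X t ω, gridInfIncr X h k t s ω))) =
          (P.map Z).prod μ := by
  have := hX.isProb
  induction k with
  | zero =>
    refine ⟨Measure.dirac (0, ⨅ _ : 0 < s, 1), inferInstance, fun t ht Z hZ => ?_⟩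
    have hZ' : Measurable Z := hZ.mono (ℱ.le t) le_rfl
    rw [Measure.prod_dirac, Measure.map_map (by fun_prop) hZ']
    congr 1
    ext ω : 1
    simp [gridInfIncr]
  | succ k ih =>
    obtain ⟨μ, hμ, ih⟩ := ih
    let Φ : (ℝ × ℝ≥0∞) × ℝ → ℝ × ℝ≥0∞ := fun p => (p.1.1 + p.2,
      min p.1.2 (⨅ _ : ENNReal.ofReal ((k + 1 : ℕ) * h) < s,
        ENNReal.ofReal (Real.exp (p.1.1 + p.2))))
    have hΦ : Measurable Φ := by
      refine Measurable.prodMk (by fun_prop) (Measurable.min (by fun_prop) ?_)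
      exact Measurable.iInf fun _ => by fun_prop
    have hXh : Measurable (X h) := hX.measurable hh
    have : IsProbabilityMeasure (P.map (X h)) := Measure.isProbabilityMeasure_map hXh.aemeasurable
    refine ⟨(μ.prod (P.map (X h))).map Φ,
      Measure.isProbabilityMeasure_map hΦ.aemeasurable, fun t ht Z hZ => ?_⟩
    have hk0 : 0 ≤ (k : ℝ) * h := by positivity
    have hZ' : Measurable Z := hZ.mono (ℱ.le t) le_rfl
    set D : Ω → ℝ := fun ω => X (t + (k + 1 : ℕ) * h) ω - X (t + k * h) ω with hD
    set V : Ω → β × (ℝ × ℝ≥0∞) :=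
      fun ω => (Z ω, (X (t + k * h) ω - X t ω, gridInfIncr X h k t s ω)) with hV
    have hlt : t + k * h ≤ t + (k + 1 : ℕ) * h := by push_cast; nlinarith
    have hDm : Measurable D :=
      (hX.measurable (by linarith)).sub (hX.measurable (by linarith))
    have hVm : Measurable[ℱ (t + k * h)] V :=
      (hZ.mono (ℱ.mono (by linarith)) le_rfl).prodMk
        (((hX.measurable_of_le (by linarith) le_rfl).sub
          (hX.measurable_of_le ht (by linarith))).prodMk (hX.measurable_gridInfIncr hh k ht s))
    have hVm' : Measurable V := hVm.mono (ℱ.le _) le_rfl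
    have hind : IndepFun V D P := by
      refine IndepFun.symm ?_
      exact indep_of_indep_of_le_right
        (hX.indepIncrements (t + k * h) (t + (k + 1 : ℕ) * h) (by linarith) hlt) hVm.comap_le
    have hDlaw : P.map D = P.map (X h) := by
      have := hX.stationary (t + k * h) (t + (k + 1 : ℕ) * h) (by linarith) hlt
      rw [this]
      congr 2
      push_cast; ring
    have hlaw := (indepFun_iff_map_prod_eq_prod_map_map hVm'.aemeasurable hDm.aemeasurable).1 hind
    rw [ih t ht Z hZ, hDlaw] at hlaw
    let Ψ : (β × (ℝ × ℝ≥0∞)) × ℝ → β × (ℝ × ℝ≥0∞) := fun p => (p.1.1, Φ (p.1.2, p.2))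
    have hΨ : Measurable Ψ := by fun_prop
    have e1 : (fun ω => (Z ω, (X (t + (k + 1 : ℕ) * h) ω - X t ω,
        gridInfIncr X h (k + 1) t s ω))) = Ψ ∘ fun ω => (V ω, D ω) := by
      ext ω : 1
      simp only [Ψ, Φ, hV, hD, Function.comp, gridInfIncr_succ]
      congr 2
      · ring
      · congr 1
        refine iInf_congr fun _ => ?_
        ring_nf
    have : IsProbabilityMeasure (P.map Z) := Measure.isProbabilityMeasure_map hZ'.aemeasurable
    rw [e1, ← Measure.map_map hΨ (hVm'.prodMk hDm), hlaw]
    have e2 : (P.map Z).prod ((μ.prod (P.map (X h))).map Φ) =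
        (((P.map Z).prod (μ.prod (P.map (X h))))).map (Prod.map id Φ) := by
      rw [← Measure.map_prod_map _ _ measurable_id hΦ, Measure.map_id]
    rw [e2, ← Measure.prodAssoc_prod, Measure.map_map (by fun_prop) (by fun_prop)]
    rfl

end Levy

lemma gridInf_le {X : ℝ → Ω → ℝ} {h : ℝ} {k : ℕ} {t : ℝ} {s : ℝ≥0∞} {ω : Ω} {j : ℕ} (hj : j ≤ k)
    (hs : ENNReal.ofReal (j * h) < s) : gridInf X h k t s ω ≤ expX X (t + j * h) ω :=
  (iInf₂_le j hj).trans (iInf_le _ hs)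

lemma expInf_le {X : ℝ → Ω → ℝ} {t u : ℝ} {s : ℝ≥0∞} {ω : Ω} (hu : 0 ≤ u)
    (hs : ENNReal.ofReal u < s) : expInf X t s ω ≤ expX X (t + u) ω :=
  (iInf₂_le u hu).trans (iInf_le _ hs)

lemma expInf_zero (X : ℝ → Ω → ℝ) (t : ℝ) (ω : Ω) : expInf X t 0 ω = ∞ := by
  simp [expInf]

/-- The dyadic grids `{j / 2 ^ n : j ≤ 4 ^ n}` increase with `n`. -/
lemma antitone_gridInf (X : ℝ → Ω → ℝ) (t : ℝ) (s : ℝ≥0∞) (ω : Ω) :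
    Antitone fun n : ℕ => gridInf X (2 ^ n)⁻¹ (4 ^ n) t s ω := by
  refine antitone_nat_of_succ_le fun n => ?_
  refine le_iInf fun j => le_iInf fun hj => le_iInf fun hs => ?_
  have e : ((2 * j : ℕ) : ℝ) * (2 ^ (n + 1))⁻¹ = j * (2 ^ n)⁻¹ := by
    push_cast; field_simp; ring
  have := gridInf_le (X := X) (t := t) (ω := ω) (s := s) (h := (2 ^ (n + 1))⁻¹) (j := 2 * j)
    (k := 4 ^ (n + 1)) (by rw [pow_succ]; omega) (by rw [e]; exact hs)
  rwa [e] at this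

lemma tendsto_expX {X : ℝ → Ω → ℝ} {ω : Ω} {t : ℝ}
    (hc : ContinuousWithinAt (fun s => X s ω) (Set.Ici t) t) :
    Tendsto (fun u => expX X u ω) (nhdsWithin t (Set.Ici t)) (nhds (expX X t ω)) :=
  ENNReal.tendsto_ofReal ((Real.continuous_exp.tendsto _).comp hc)

lemma tendsto_ceil_dyadic (u : ℝ) (hu : 0 ≤ u) :
    Tendsto (fun n : ℕ => (⌈u * 2 ^ n⌉₊ : ℝ) * (2 ^ n)⁻¹) atTop (nhdsWithin u (Set.Ici u)) := by
  have hpos : ∀ n : ℕ, (0 : ℝ) < 2 ^ n := fun n => by positivity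
  have hge : ∀ n : ℕ, u ≤ (⌈u * 2 ^ n⌉₊ : ℝ) * (2 ^ n)⁻¹ := fun n => by
    rw [← div_eq_mul_inv, le_div_iff₀ (hpos n)]
    exact Nat.le_ceil _
  refine tendsto_nhdsWithin_iff.2 ⟨?_, Eventually.of_forall hge⟩
  refine tendsto_of_tendsto_of_tendsto_of_le_of_le tendsto_const_nhds
    (h := fun n : ℕ => u + (2 ^ n)⁻¹) ?_ hge ?_
  · have h2 : Tendsto (fun n : ℕ => ((2 : ℝ) ^ n)⁻¹) atTop (nhds 0) :=
      tendsto_inv_atTop_zero.comp (tendsto_pow_atTop_atTop_of_one_lt (by norm_num))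
    simpa using h2.const_add u
  · intro n
    have h1 := (Nat.ceil_lt_add_one (a := u * 2 ^ n) (by have := hpos n; positivity)).le
    have h2 : (0 : ℝ) < 2 ^ n := hpos n
    show (⌈u * 2 ^ n⌉₊ : ℝ) * (2 ^ n)⁻¹ ≤ u + (2 ^ n)⁻¹
    rw [← div_eq_mul_inv, div_le_iff₀ h2, add_mul, inv_mul_cancel₀ h2.ne']
    exact h1

lemma expInf_eq_iInf_gridInf {X : ℝ → Ω → ℝ} {ω : Ω} {t : ℝ} (ht : 0 ≤ t) (s : ℝ≥0∞)
    (hc : ∀ t : ℝ, 0 ≤ t → ContinuousWithinAt (fun s => X s ω) (Set.Ici t) t) :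
    expInf X t s ω = ⨅ n : ℕ, gridInf X (2 ^ n)⁻¹ (4 ^ n) t s ω := by
  apply le_antisymm
  · exact le_iInf fun n => le_iInf fun j => le_iInf fun _ => le_iInf fun hs =>
      expInf_le (by positivity) hs
  · refine le_iInf fun u => le_iInf fun hu => le_iInf fun hs => ?_
    have hlim := tendsto_ceil_dyadic u hu
    have h1 : Tendsto (fun n : ℕ => t + (⌈u * 2 ^ n⌉₊ : ℝ) * (2 ^ n)⁻¹) atTop
        (nhdsWithin (t + u) (Set.Ici (t + u))) := by
      refine tendsto_nhdsWithin_iff.2 ⟨(tendsto_nhdsWithin_iff.1 hlim).1.const_add t, ?_⟩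
      filter_upwards [(tendsto_nhdsWithin_iff.1 hlim).2] with n hn
      simpa using hn
    have h2 := (tendsto_expX (hc (t + u) (by linarith))).comp h1
    refine ge_of_tendsto h2 ?_
    have h3 : ∀ᶠ n : ℕ in atTop,
        ENNReal.ofReal ((⌈u * 2 ^ n⌉₊ : ℝ) * (2 ^ n)⁻¹) < s :=
      (ENNReal.tendsto_ofReal (tendsto_nhdsWithin_iff.1 hlim).1).eventually_lt_const hs
    have h4 : ∀ᶠ n : ℕ in atTop, u ≤ 2 ^ n :=
      (tendsto_pow_atTop_atTop_of_one_lt (by norm_num : (1 : ℝ) < 2)).eventually_ge_atTop u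
    filter_upwards [h3, h4] with n hn hn'
    refine (iInf_le _ n).trans (gridInf_le ?_ hn)
    refine Nat.ceil_le.2 ?_
    push_cast
    calc u * 2 ^ n ≤ 2 ^ n * 2 ^ n := by gcongr
      _ = 4 ^ n := by rw [← mul_pow]; norm_num

section Levy

variable [m0 : MeasurableSpace Ω] {P : Measure Ω} {ℱ : Filtration ℝ m0} {X : ℝ → Ω → ℝ}

lemma IsLevy.measurable_gridInf (hX : IsLevy P ℱ X) {h : ℝ} (hh : 0 ≤ h) (k : ℕ)
    {t : ℝ} (ht : 0 ≤ t) :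
    Measurable fun p : ℝ≥0∞ × Ω => gridInf X h k t p.1 p.2 := by
  unfold gridInf
  refine Measurable.iInf fun j => Measurable.iInf fun hj => ?_
  have h0 : 0 ≤ (j : ℝ) * h := by positivity
  have hm : Measurable (expX X (t + j * h)) :=
    (hX.measurable_expX (by linarith)).mono (ℱ.le _) le_rfl
  simp only [iInf_eq_if]
  exact Measurable.ite (measurableSet_lt measurable_const measurable_fst)
    (hm.comp measurable_snd) measurable_const

lemma IsLevy.measurable_gridInf_apply (hX : IsLevy P ℱ X) {h : ℝ} (hh : 0 ≤ h) (k : ℕ)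
    {t : ℝ} (ht : 0 ≤ t) (s : ℝ≥0∞) : Measurable (gridInf X h k t s) := by
  have h1 := (hX.measurable_gridInf hh k ht).comp (measurable_prodMk_left (x := s))
  simpa only [Function.comp_def] using h1

lemma IsLevy.measurable_expInf (hX : IsLevy P ℱ X) {t : ℝ} (ht : 0 ≤ t) :
    Measurable fun p : ℝ≥0∞ × Ω => expInf X t p.1 p.2 := by
  simp only [fun p : ℝ≥0∞ × Ω => expInf_eq_iInf_gridInf ht p.1 (hX.rightCont p.2)]
  exact Measurable.iInf fun n => hX.measurable_gridInf (by positivity) (4 ^ n) ht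

lemma IsLevy.measurable_expInf_apply (hX : IsLevy P ℱ X) {t : ℝ} (ht : 0 ≤ t) (s : ℝ≥0∞) :
    Measurable (expInf X t s) := by
  have h1 := (hX.measurable_expInf ht).comp (measurable_prodMk_left (x := s))
  simpa only [Function.comp_def] using h1

lemma IsLevy.expX_zero (hX : IsLevy P ℱ X) : ∀ᵐ ω ∂P, expX X 0 ω = 1 := by
  filter_upwards [hX.zero] with ω hω
  simp [expX, hω]

lemma IsLevy.setLIntegral_gridInf (hX : IsLevy P ℱ X) {h : ℝ} (hh : 0 ≤ h) (k : ℕ)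
    {t : ℝ} (ht : 0 ≤ t) (s : ℝ≥0∞) {A : Set Ω} (hA : MeasurableSet[ℱ t] A) (B c : ℝ≥0∞) :
    ∫⁻ ω in A, (B - c * gridInf X h k t s ω) ∂P =
      ∫⁻ ω in A, ∫⁻ ω', (B - c * expX X t ω * gridInf X h k 0 s ω') ∂P ∂P := by
  have := hX.isProb
  obtain ⟨μ, hμ, hlaw⟩ := hX.exists_map_eq_prod (β := ℝ≥0∞ × ℝ≥0∞) hh s k
  have hA' : MeasurableSet A := ℱ.le t A hA
  have hG : ∀ t : ℝ, 0 ≤ t → Measurable (gridInfIncr X h k t s) := fun t ht =>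
    (hX.measurable_gridInfIncr hh k ht s).mono (ℱ.le _) le_rfl
  have hk0 : 0 ≤ (k : ℝ) * h := by positivity
  have hD : ∀ t : ℝ, 0 ≤ t → Measurable fun ω => X (t + k * h) ω - X t ω := fun t ht =>
    (hX.measurable (by linarith)).sub (hX.measurable ht)
  have hμlaw : μ.map Prod.snd = P.map (gridInfIncr X h k 0 s) := by
    have h1 := congrArg (Measure.map fun q : (ℝ≥0∞ × ℝ≥0∞) × (ℝ × ℝ≥0∞) => q.2.2)
      (hlaw 0 le_rfl (fun _ => (0, 0)) measurable_const)
    rw [Measure.map_map (by fun_prop) (by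
      exact measurable_const.prodMk ((hD 0 le_rfl).prodMk (hG 0 le_rfl)))] at h1
    rw [Measure.map_const, measure_univ, one_smul, Measure.dirac_prod,
      Measure.map_map (by fun_prop) (by fun_prop)] at h1
    exact h1.symm
  have hinner : ∀ y : ℝ≥0∞, ∫⁻ q, (B - y * q.2) ∂μ =
      ∫⁻ ω', (B - y * gridInf X h k 0 s ω') ∂P := by
    intro y
    have hm : Measurable fun x : ℝ≥0∞ => B - y * x := by fun_prop
    calc ∫⁻ q, (B - y * q.2) ∂μ = ∫⁻ x, (B - y * x) ∂(μ.map Prod.snd) :=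
          (lintegral_map hm measurable_snd).symm
      _ = ∫⁻ ω', (B - y * gridInfIncr X h k 0 s ω') ∂P := by
          rw [hμlaw, lintegral_map hm (hG 0 le_rfl)]
      _ = _ := by
          refine lintegral_congr_ae ?_
          filter_upwards [hX.expX_zero] with ω hω
          rw [gridInf_eq, hω, one_mul]
  let Z : Ω → ℝ≥0∞ × ℝ≥0∞ := fun ω => (expX X t ω, A.indicator (fun _ => 1) ω)
  have hZ : Measurable[ℱ t] Z :=
    (hX.measurable_expX ht).prodMk ((@measurable_const _ _ _ (ℱ t) (1 : ℝ≥0∞)).indicator hA)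
  have hZ' : Measurable Z := hZ.mono (ℱ.le t) le_rfl
  let F : (ℝ≥0∞ × ℝ≥0∞) × (ℝ × ℝ≥0∞) → ℝ≥0∞ := fun p => p.1.2 * (B - c * p.1.1 * p.2.2)
  have hF : Measurable F := by fun_prop
  have e1 : ∫⁻ ω in A, (B - c * gridInf X h k t s ω) ∂P =
      ∫⁻ ω, F (Z ω, (X (t + k * h) ω - X t ω, gridInfIncr X h k t s ω)) ∂P := by
    rw [← lintegral_indicator hA']
    refine lintegral_congr fun ω => ?_
    by_cases hω : ω ∈ A <;> simp [F, Z, hω, gridInf_eq, mul_assoc]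
  rw [e1, ← lintegral_map hF (hZ'.prodMk ((hD t ht).prodMk (hG t ht))), hlaw t ht Z hZ,
    lintegral_prod _ hF.aemeasurable, lintegral_map hF.lintegral_prod_right' hZ',
    ← lintegral_indicator hA']
  refine lintegral_congr fun ω => ?_
  by_cases hω : ω ∈ A
  · simp [F, Z, hω, hinner]
  · simp [F, Z, hω]

lemma sub_mul_iInf {B c : ℝ≥0∞} (hc0 : c ≠ 0) (hc : c ≠ ∞) (f : ℕ → ℝ≥0∞) :
    B - c * ⨅ n, f n = ⨆ n, (B - c * f n) := by
  rw [ENNReal.mul_iInf_of_ne hc0 hc, ENNReal.sub_iInf]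

/-- The Markov property at a fixed time `t`, for the functional `B - c e^{inf X}`. -/
lemma IsLevy.setLIntegral_expInf (hX : IsLevy P ℱ X) {t : ℝ} (ht : 0 ≤ t) (s : ℝ≥0∞) {A : Set Ω}
    (hA : MeasurableSet[ℱ t] A) (B : ℝ≥0∞) {c : ℝ≥0∞} (hc0 : c ≠ 0) (hc : c ≠ ∞) :
    ∫⁻ ω in A, (B - c * expInf X t s ω) ∂P =
      ∫⁻ ω in A, ∫⁻ ω', (B - c * expX X t ω * expInf X 0 s ω') ∂P ∂P := by
  have := hX.isProb
  have hm : ∀ n (t : ℝ), 0 ≤ t → Measurable (gridInf X (2 ^ n)⁻¹ (4 ^ n) t s) :=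
    fun n t ht => hX.measurable_gridInf_apply (by positivity) (4 ^ n) ht s
  have hex : Measurable (expX X t) := (hX.measurable_expX ht).mono (ℱ.le _) le_rfl
  have hmono : ∀ (c : ℝ≥0∞) (t : ℝ),
      Monotone fun (n : ℕ) ω => B - c * gridInf X (2 ^ n)⁻¹ (4 ^ n) t s ω := by
    intro c t i j hij ω
    have := antitone_gridInf X t s ω hij
    dsimp only at this ⊢
    gcongr
  have hmB : ∀ (n : ℕ) (c : ℝ≥0∞) (t : ℝ), 0 ≤ t →
      Measurable fun ω => B - c * gridInf X (2 ^ n)⁻¹ (4 ^ n) t s ω :=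
    fun n c t ht => measurable_const.sub ((hm n t ht).const_mul c)
  have key : ∀ ω, ∫⁻ ω', (B - c * expX X t ω * expInf X 0 s ω') ∂P =
      ⨆ n : ℕ, ∫⁻ ω', (B - c * expX X t ω * gridInf X (2 ^ n)⁻¹ (4 ^ n) 0 s ω') ∂P := by
    intro ω
    simp only [fun ω => expInf_eq_iInf_gridInf le_rfl s (hX.rightCont ω)]
    simp only [sub_mul_iInf (mul_ne_zero hc0 (expX_ne_zero X t ω))
      (ENNReal.mul_ne_top hc (expX_ne_top X t ω))]
    exact lintegral_iSup (fun n => hmB n _ 0 le_rfl)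
      (hmono _ _)
  simp only [key]
  simp only [fun ω => expInf_eq_iInf_gridInf ht s (hX.rightCont ω), sub_mul_iInf hc0 hc]
  rw [lintegral_iSup (fun n => hmB n c t ht) (hmono _ _),
    lintegral_iSup]
  · exact iSup_congr fun n => hX.setLIntegral_gridInf (by positivity) (4 ^ n) ht s hA B c
  · intro n
    have : Measurable fun p : Ω × Ω =>
        B - c * expX X t p.1 * gridInf X (2 ^ n)⁻¹ (4 ^ n) 0 s p.2 := by
      refine measurable_const.sub (((hex.comp measurable_fst).const_mul c).mul
        ((hm n 0 le_rfl).comp measurable_snd))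
    exact this.lintegral_prod_right'
  · intro i j hij ω
    exact lintegral_mono (hmono _ _ hij)

end Levy

/-- A law on `[0, ∞]` with the lack-of-memory property at rate `r`: the exponential law if `r > 0`,
the unit mass at `∞` if `r = 0`. -/
structure IsClock (r : ℝ) (κ : Measure ℝ≥0∞) : Prop where
  isProb : IsProbabilityMeasure κ
  pos : ∀ᵐ s ∂κ, 0 < s
  memoryless : ∀ t : ℝ, 0 ≤ t → ∀ F : ℝ≥0∞ → ℝ≥0∞, Measurable F → F 0 = 0 →
    ∫⁻ s, F (s - ENNReal.ofReal t) ∂κ = ENNReal.ofReal (Real.exp (-(r * t))) * ∫⁻ s, F s ∂κ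

/-- `E[e^{X̲_e}]` for an independent time `e` of law `κ`. -/
def meanInf [MeasurableSpace Ω] (P : Measure Ω) (X : ℝ → Ω → ℝ) (κ : Measure ℝ≥0∞) : ℝ≥0∞ :=
  ∫⁻ p, expInf X 0 p.1 p.2 ∂(κ.prod P)

/-- `E[(B - c e^{X̲_e})^+]` for an independent time `e` of law `κ`. -/
def excess [MeasurableSpace Ω] (P : Measure Ω) (X : ℝ → Ω → ℝ) (κ : Measure ℝ≥0∞)
    (B c : ℝ≥0∞) : ℝ≥0∞ :=
  ∫⁻ p, (B - c * expInf X 0 p.1 p.2) ∂(κ.prod P)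

/-- The event that `k` is the first index of an event of the sequence `B` that occurs. -/
def firstAt (B : ℕ → Set Ω) (k : ℕ) : Set Ω := {ω | ω ∈ B k ∧ ∀ j < k, ω ∉ B j}

lemma pairwise_disjoint_firstAt (B : ℕ → Set Ω) :
    Pairwise (Function.onFun Disjoint (firstAt B)) := by
  intro i j hij
  refine Set.disjoint_left.2 fun ω hi hj => ?_
  rcases lt_or_gt_of_ne hij with h | h
  · exact hj.2 i h hi.1
  · exact hi.2 j h hj.1

lemma exists_mem_firstAt {B : ℕ → Set Ω} {ω : Ω} {j : ℕ} (hj : ω ∈ B j) :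
    ∃ k ≤ j, ω ∈ firstAt B k := by
  classical
  have h : ∃ j, ω ∈ B j := ⟨j, hj⟩
  exact ⟨Nat.find h, Nat.find_min' h hj, Nat.find_spec h, fun i hi => Nat.find_min h hi⟩

lemma measurableSet_firstAt [m0 : MeasurableSpace Ω] {ℱ : Filtration ℝ m0} {h : ℝ} (hh : 0 ≤ h)
    {B : ℕ → Set Ω} (hB : ∀ k : ℕ, MeasurableSet[ℱ (k * h)] (B k)) (k : ℕ) :
    MeasurableSet[ℱ (k * h)] (firstAt B k) := by
  have e : firstAt B k = B k ∩ ⋂ j : ℕ, ⋂ _ : j < k, (B j)ᶜ := by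
    ext ω; simp [firstAt]
  rw [e]
  refine (hB k).inter (MeasurableSet.iInter fun j => MeasurableSet.iInter fun hj => ?_)
  exact (ℱ.mono (by gcongr) _ (hB j)).compl

section Levy

variable [m0 : MeasurableSpace Ω] {P : Measure Ω} {ℱ : Filtration ℝ m0} {X : ℝ → Ω → ℝ}
  {r : ℝ} {κ : Measure ℝ≥0∞}

/-- The Markov property at a fixed time, combined with the lack of memory of the clock. -/
lemma IsLevy.lintegral_clock (hX : IsLevy P ℱ X) (hκ : IsClock r κ) {t : ℝ} (ht : 0 ≤ t)
    {A : Set Ω} (hA : MeasurableSet[ℱ t] A) (B : ℝ≥0∞) {c : ℝ≥0∞} (hc0 : c ≠ 0) (hc : c ≠ ∞) :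
    ∫⁻ s, ∫⁻ ω in A, (B - c * expInf X t (s - ENNReal.ofReal t) ω) ∂P ∂κ =
      ENNReal.ofReal (Real.exp (-(r * t))) * ∫⁻ ω in A, excess P X κ B (c * expX X t ω) ∂P := by
  have := hX.isProb
  have := hκ.isProb
  have hm : Measurable fun p : ℝ≥0∞ × Ω => B - c * expInf X t p.1 p.2 :=
    measurable_const.sub ((hX.measurable_expInf ht).const_mul c)
  have hex : Measurable (expX X t) := (hX.measurable_expX ht).mono (ℱ.le _) le_rfl
  have h3 : Measurable fun q : (ℝ≥0∞ × Ω) × Ω =>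
      B - c * expX X t q.1.2 * expInf X 0 q.1.1 q.2 := by
    have h1 := (hX.measurable_expInf le_rfl).comp
      (g := fun p : ℝ≥0∞ × Ω => expInf X 0 p.1 p.2) (f := fun q : (ℝ≥0∞ × Ω) × Ω => (q.1.1, q.2))
      (by fun_prop)
    have h2 := hex.comp (f := fun q : (ℝ≥0∞ × Ω) × Ω => q.1.2) (by fun_prop)
    simp only [Function.comp_def] at h1 h2
    exact measurable_const.sub ((h2.const_mul c).mul h1)
  rw [hκ.memoryless t ht (fun s => ∫⁻ ω in A, (B - c * expInf X t s ω) ∂P)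
    hm.lintegral_prod_right' (by simp [expInf_zero, ENNReal.mul_top hc0])]
  congr 1
  simp only [fun s => hX.setLIntegral_expInf ht s hA B hc0 hc]
  rw [lintegral_lintegral_swap h3.lintegral_prod_right'.aemeasurable]
  refine lintegral_congr fun ω => ?_
  rw [excess, lintegral_prod]
  exact (measurable_const.sub ((hX.measurable_expInf le_rfl).const_mul _)).aemeasurable

lemma IsLevy.expInf_le_one (hX : IsLevy P ℱ X) (hκ : IsClock r κ) :
    ∀ᵐ p ∂(κ.prod P), expInf X 0 p.1 p.2 ≤ 1 := by
  have := hX.isProb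
  have := hκ.isProb
  filter_upwards [Measure.quasiMeasurePreserving_fst.ae hκ.pos,
    Measure.quasiMeasurePreserving_snd.ae hX.expX_zero] with p hp hp'
  have := expInf_le (X := X) (t := 0) (ω := p.2) (s := p.1) le_rfl (by simpa using hp)
  simpa [hp'] using this

lemma IsLevy.meanInf_le_one (hX : IsLevy P ℱ X) (hκ : IsClock r κ) : meanInf P X κ ≤ 1 := by
  have := hX.isProb
  have := hκ.isProb
  calc meanInf P X κ ≤ ∫⁻ _, 1 ∂(κ.prod P) := lintegral_mono_ae (hX.expInf_le_one hκ)
    _ = 1 := by simp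

lemma IsLevy.mul_sub_le_excess (hX : IsLevy P ℱ X) (hκ : IsClock r κ) (K y : ℝ≥0∞) :
    meanInf P X κ * (K - y) ≤ excess P X κ (K * meanInf P X κ) y := by
  have := hX.isProb
  have := hκ.isProb
  have hM : meanInf P X κ ≠ ∞ := ne_top_of_le_ne_top ENNReal.one_ne_top (hX.meanInf_le_one hκ)
  have hm := hX.measurable_expInf le_rfl
  calc meanInf P X κ * (K - y) = ∫⁻ _, K * meanInf P X κ ∂(κ.prod P) -
        ∫⁻ p, y * expInf X 0 p.1 p.2 ∂(κ.prod P) := by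
        rw [lintegral_const_mul _ hm, ← meanInf, ENNReal.mul_sub fun _ _ => hM]
        simp [mul_comm]
    _ ≤ _ := lintegral_sub_le _ _ (hm.const_mul y)

lemma IsLevy.excess_eq (hX : IsLevy P ℱ X) (hκ : IsClock r κ) {K y : ℝ≥0∞} (hK : K ≠ ∞)
    (hy : y ≤ K * meanInf P X κ) :
    excess P X κ (K * meanInf P X κ) y = meanInf P X κ * (K - y) := by
  have := hX.isProb
  have := hκ.isProb
  have hM : meanInf P X κ ≠ ∞ := ne_top_of_le_ne_top ENNReal.one_ne_top (hX.meanInf_le_one hκ)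
  have hm := hX.measurable_expInf le_rfl
  have hy' : y ≠ ∞ := ne_top_of_le_ne_top (ENNReal.mul_ne_top hK hM) hy
  rw [excess, lintegral_sub (hm.const_mul y), lintegral_const_mul _ hm, ← meanInf,
    ENNReal.mul_sub fun _ _ => hM]
  · simp [mul_comm]
  · rw [lintegral_const_mul _ hm, ← meanInf]
    exact ENNReal.mul_ne_top hy' hM
  · filter_upwards [hX.expInf_le_one hκ] with p hp
    calc y * expInf X 0 p.1 p.2 ≤ y * 1 := by gcongr
      _ ≤ _ := by simpa using hy

/-- The discounted payoff of stopping at time `k h` on `A k` is dominated by the value at time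
`0`, whatever the disjoint events `A k`. -/
lemma IsLevy.tsum_payoff_le (hX : IsLevy P ℱ X) (hκ : IsClock r κ) {h : ℝ} (hh : 0 ≤ h)
    {A : ℕ → Set Ω} (hA : ∀ k : ℕ, MeasurableSet[ℱ (k * h)] (A k))
    (hdisj : Pairwise (Function.onFun Disjoint A)) {K c : ℝ≥0∞}
    (hc0 : c ≠ 0) (hc : c ≠ ∞) :
    meanInf P X κ * ∑' k : ℕ, ∫⁻ ω in A k,
        ENNReal.ofReal (Real.exp (-(r * (k * h)))) * (K - c * expX X (k * h) ω) ∂P ≤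
      excess P X κ (K * meanInf P X κ) c := by
  have := hX.isProb
  have := hκ.isProb
  set M := meanInf P X κ with hMdef
  have hM : M ≠ ∞ := ne_top_of_le_ne_top ENNReal.one_ne_top (hX.meanInf_le_one hκ)
  have hA' : ∀ k, MeasurableSet (A k) := fun k => ℱ.le _ _ (hA k)
  have hm0 : Measurable fun p : ℝ≥0∞ × Ω => K * M - c * expInf X 0 p.1 p.2 :=
    measurable_const.sub ((hX.measurable_expInf le_rfl).const_mul c)
  rw [← ENNReal.tsum_mul_left]
  have hterm : ∀ k : ℕ, M * ∫⁻ ω in A k,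
      ENNReal.ofReal (Real.exp (-(r * (k * h)))) * (K - c * expX X (k * h) ω) ∂P ≤
      ∫⁻ s, ∫⁻ ω in A k, (K * M - c * expInf X 0 s ω) ∂P ∂κ := by
    intro k
    have hk : 0 ≤ (k : ℝ) * h := by positivity
    calc M * ∫⁻ ω in A k,
          ENNReal.ofReal (Real.exp (-(r * (k * h)))) * (K - c * expX X (k * h) ω) ∂P
        = ENNReal.ofReal (Real.exp (-(r * (k * h)))) *
          ∫⁻ ω in A k, M * (K - c * expX X (k * h) ω) ∂P := by
          rw [lintegral_const_mul' _ _ ENNReal.ofReal_ne_top, lintegral_const_mul' _ _ hM]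
          ring
      _ ≤ ENNReal.ofReal (Real.exp (-(r * (k * h)))) *
          ∫⁻ ω in A k, excess P X κ (K * M) (c * expX X (k * h) ω) ∂P := by
          gcongr
          exact hX.mul_sub_le_excess hκ _ _
      _ = ∫⁻ s, ∫⁻ ω in A k, (K * M - c * expInf X (k * h) (s - ENNReal.ofReal (k * h)) ω) ∂P ∂κ :=
          (hX.lintegral_clock hκ hk (hA k) (K * M) hc0 hc).symm
      _ ≤ _ := by
          gcongr with s ω
          refine le_iInf fun u => le_iInf fun hu => le_iInf fun hs => ?_
          have hs' : ENNReal.ofReal (k * h + u) < s := by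
            rw [ENNReal.ofReal_add hk hu]
            exact lt_tsub_iff_left.1 hs
          simpa using expInf_le (X := X) (t := 0) (ω := ω) (add_nonneg hk hu) hs'
  refine (ENNReal.tsum_le_tsum hterm).trans ?_
  rw [← lintegral_tsum fun k => hm0.lintegral_prod_right'.aemeasurable, excess,
    lintegral_prod _ hm0.aemeasurable]
  refine lintegral_mono fun s => ?_
  rw [← lintegral_iUnion hA' hdisj]
  exact setLIntegral_le_lintegral _ _

/-- The value of stopping at the first dyadic time at which `c e^X` is below `K E[e^{X̲_e}]`. -/
lemma IsLevy.le_tsum_payoff (hX : IsLevy P ℱ X) (hκ : IsClock r κ) {K c : ℝ≥0∞} (hK : K ≠ ∞)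
    (hc0 : c ≠ 0) (hc : c ≠ ∞) (h : ℝ) (hh : 0 ≤ h) (N : ℕ) {A : ℕ → Set Ω}
    (hAdef : A = firstAt fun k : ℕ => {ω | c * expX X (k * h) ω < K * meanInf P X κ}) :
    ∫⁻ p, (K * meanInf P X κ - c * gridInf X h N 0 p.1 p.2) ∂(κ.prod P) ≤
      meanInf P X κ * ∑' k : ℕ, ∫⁻ ω in A k,
        ENNReal.ofReal (Real.exp (-(r * (k * h)))) * (K - c * expX X (k * h) ω) ∂P := by
  have := hX.isProb
  have := hκ.isProb
  set M := meanInf P X κ with hMdef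
  have hM : M ≠ ∞ := ne_top_of_le_ne_top ENNReal.one_ne_top (hX.meanInf_le_one hκ)
  have hk : ∀ k : ℕ, 0 ≤ (k : ℝ) * h := fun k => by positivity
  have hA : ∀ k : ℕ, MeasurableSet[ℱ (k * h)] (A k) := by
    rw [hAdef]
    refine measurableSet_firstAt hh fun k => ?_
    exact measurableSet_lt ((hX.measurable_expX (hk k)).const_mul c)
      (@measurable_const _ _ _ (ℱ (k * h)) _)
  have hA' : ∀ k, MeasurableSet (A k) := fun k => ℱ.le _ _ (hA k)
  have hmk : ∀ k : ℕ, Measurable fun p : ℝ≥0∞ × Ω =>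
      K * M - c * expInf X (k * h) (p.1 - ENNReal.ofReal (k * h)) p.2 := fun k =>
    measurable_const.sub (((hX.measurable_expInf (hk k)).comp
      ((measurable_fst.sub measurable_const).prodMk measurable_snd)).const_mul c)
  have hterm : ∀ k : ℕ, M * ∫⁻ ω in A k,
      ENNReal.ofReal (Real.exp (-(r * (k * h)))) * (K - c * expX X (k * h) ω) ∂P =
      ∫⁻ s, ∫⁻ ω in A k, (K * M - c * expInf X (k * h) (s - ENNReal.ofReal (k * h)) ω) ∂P ∂κ := by
    intro k
    calc M * ∫⁻ ω in A k,
          ENNReal.ofReal (Real.exp (-(r * (k * h)))) * (K - c * expX X (k * h) ω) ∂P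
        = ENNReal.ofReal (Real.exp (-(r * (k * h)))) *
          ∫⁻ ω in A k, M * (K - c * expX X (k * h) ω) ∂P := by
          rw [lintegral_const_mul' _ _ ENNReal.ofReal_ne_top, lintegral_const_mul' _ _ hM]
          ring
      _ = ENNReal.ofReal (Real.exp (-(r * (k * h)))) *
          ∫⁻ ω in A k, excess P X κ (K * M) (c * expX X (k * h) ω) ∂P := by
          congr 1
          refine setLIntegral_congr_fun (hA' k) fun ω hω => ?_
          rw [hAdef] at hω
          exact (hX.excess_eq hκ hK (le_of_lt hω.1)).symm
      _ = _ := (hX.lintegral_clock hκ (hk k) (hA k) (K * M) hc0 hc).symm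
  rw [← ENNReal.tsum_mul_left]
  simp only [hterm]
  rw [← lintegral_tsum fun k => (hmk k).lintegral_prod_right'.aemeasurable, lintegral_prod]
  swap
  · exact (measurable_const.sub ((hX.measurable_gridInf hh N le_rfl).const_mul c)).aemeasurable
  refine lintegral_mono fun s => ?_
  simp only [← lintegral_indicator (hA' _)]
  have hmi : ∀ k : ℕ, Measurable ((A k).indicator fun ω =>
      K * M - c * expInf X (k * h) (s - ENNReal.ofReal (k * h)) ω) := fun k =>
    (measurable_const.sub ((hX.measurable_expInf_apply (hk k) _).const_mul c)).indicator (hA' k)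
  rw [← lintegral_tsum fun k => (hmi k).aemeasurable]
  refine lintegral_mono fun ω => ?_
  set S := ∑' k : ℕ, (A k).indicator
    (fun ω => K * M - c * expInf X (k * h) (s - ENNReal.ofReal (k * h)) ω) ω with hS
  show K * M - c * gridInf X h N 0 s ω ≤ S
  have hle : (K * M - S) / c ≤ gridInf X h N 0 s ω := by
    refine le_iInf fun j => le_iInf fun _ => le_iInf fun hs => ?_
    rw [zero_add]
    refine ENNReal.div_le_of_le_mul ?_
    rw [tsub_le_iff_left, ← tsub_le_iff_right, mul_comm (expX X (j * h) ω) c]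
    rcases le_or_gt (K * M) (c * expX X (j * h) ω) with hj | hj
    · rw [tsub_eq_zero_of_le hj]
      exact zero_le
    obtain ⟨k, hkj, hkA⟩ := exists_mem_firstAt
      (B := fun k : ℕ => {ω | c * expX X (k * h) ω < K * M}) (ω := ω) (j := j) hj
    rw [← hAdef] at hkA
    have hkj' : (k : ℝ) * h ≤ j * h := by gcongr
    have hinf : expInf X (k * h) (s - ENNReal.ofReal (k * h)) ω ≤ expX X (j * h) ω := by
      have := expInf_le (X := X) (t := k * h) (u := j * h - k * h)
        (s := s - ENNReal.ofReal (k * h)) (ω := ω) (by linarith)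
        (by rwa [lt_tsub_iff_left, ← ENNReal.ofReal_add (hk k) (by linarith), add_sub_cancel])
      rwa [add_sub_cancel] at this
    calc K * M - c * expX X (j * h) ω
        ≤ K * M - c * expInf X (k * h) (s - ENNReal.ofReal (k * h)) ω := by gcongr
      _ = (A k).indicator
          (fun ω => K * M - c * expInf X (k * h) (s - ENNReal.ofReal (k * h)) ω) ω := by
          rw [Set.indicator_of_mem hkA]
      _ ≤ S := ENNReal.le_tsum k
  rw [tsub_le_iff_left, ← tsub_le_iff_right]
  calc K * M - S ≤ gridInf X h N 0 s ω * c :=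
        (ENNReal.div_le_iff hc0 hc).1 hle
    _ = _ := mul_comm _ _

end Levy

lemma ofReal_putPayoff (X : ℝ → Ω → ℝ) (r x : ℝ) {K : ℝ} (τ : Ω → ℝ≥0∞) (ω : Ω) :
    ENNReal.ofReal (putPayoff X r K x τ ω) = if τ ω = ∞ then 0 else
      ENNReal.ofReal (Real.exp (-(r * (τ ω).toReal))) *
        (ENNReal.ofReal K - ENNReal.ofReal (Real.exp x) * expX X (τ ω).toReal ω) := by
  by_cases h : τ ω = ∞
  · simp [putPayoff, stopPayoff, h]
  · rw [putPayoff, stopPayoff, if_pos h, if_neg h, ENNReal.ofReal_mul (Real.exp_pos _).le, expX,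
      ← ENNReal.ofReal_mul (Real.exp_pos x).le, ← Real.exp_add,
      ← ENNReal.ofReal_sub _ (Real.exp_pos _).le]
    congr 1
    rcases le_total (K - Real.exp (x + X (τ ω).toReal ω)) 0 with h | h
    · rw [max_eq_right h, ENNReal.ofReal_zero, ENNReal.ofReal_of_nonpos h]
    · rw [max_eq_left h]

lemma putPayoff_nonneg (X : ℝ → Ω → ℝ) (r x K : ℝ) (τ : Ω → ℝ≥0∞) (ω : Ω) :
    0 ≤ putPayoff X r K x τ ω := by
  unfold putPayoff stopPayoff
  split_ifs <;> positivity

/-- The discounted put payoff at time `u`, as an extended nonnegative real. -/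
def discPayoff (X : ℝ → Ω → ℝ) (r : ℝ) (K c : ℝ≥0∞) (u : ℝ) (ω : Ω) : ℝ≥0∞ :=
  ENNReal.ofReal (Real.exp (-(r * u))) * (K - c * expX X u ω)

/-- The time `k h`, where `k` is the first index of an event of the sequence `B` that occurs. -/
def gridTime (h : ℝ) (B : ℕ → Set Ω) (ω : Ω) : ℝ≥0∞ :=
  if H : ∃ k, ω ∈ B k then ENNReal.ofReal (Nat.find H * h) else ∞

lemma gridTime_eq {h : ℝ} {B : ℕ → Set Ω} {ω : Ω} {k : ℕ} (hk : ω ∈ firstAt B k) :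
    gridTime h B ω = ENNReal.ofReal (k * h) := by
  have H : ∃ k, ω ∈ B k := ⟨k, hk.1⟩
  rw [gridTime, dif_pos H, (Nat.find_eq_iff H).2 ⟨hk.1, hk.2⟩]

lemma gridTime_eq_top {h : ℝ} {B : ℕ → Set Ω} {ω : Ω} (H : ¬ ∃ k, ω ∈ B k) :
    gridTime h B ω = ∞ := dif_neg H

lemma tsum_indicator_firstAt {B : ℕ → Set Ω} {ω : Ω} {k : ℕ} (hk : ω ∈ firstAt B k)
    (f : ℕ → Ω → ℝ≥0∞) : ∑' j, (firstAt B j).indicator (f j) ω = f k ω := by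
  rw [tsum_eq_single k, Set.indicator_of_mem hk]
  intro j hj
  exact Set.indicator_of_notMem
    (fun hmem => Set.disjoint_left.1 (pairwise_disjoint_firstAt B hj) hmem hk) _

lemma ofReal_putPayoff_gridTime (X : ℝ → Ω → ℝ) (r x : ℝ) {K h : ℝ} (hh : 0 ≤ h)
    (B : ℕ → Set Ω) (ω : Ω) :
    ENNReal.ofReal (putPayoff X r K x (gridTime h B) ω) = ∑' k : ℕ, (firstAt B k).indicator
      (discPayoff X r (ENNReal.ofReal K) (ENNReal.ofReal (Real.exp x)) (k * h)) ω := by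
  rw [ofReal_putPayoff]
  by_cases H : ∃ k, ω ∈ B k
  · obtain ⟨j, hj⟩ := H
    obtain ⟨k, -, hk⟩ := exists_mem_firstAt hj
    rw [tsum_indicator_firstAt hk (fun k : ℕ => discPayoff X r (ENNReal.ofReal K)
      (ENNReal.ofReal (Real.exp x)) (k * h)), gridTime_eq hk, if_neg ENNReal.ofReal_ne_top,
      ENNReal.toReal_ofReal (by positivity), discPayoff]
  · rw [if_pos (gridTime_eq_top H)]
    refine (ENNReal.tsum_eq_zero.2 fun k => Set.indicator_of_notMem (fun hk => ?_) _).symm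
    exact H ⟨k, hk.1⟩

lemma isStopTime_gridTime [m0 : MeasurableSpace Ω] {ℱ : Filtration ℝ m0} {h : ℝ} (hh : 0 ≤ h)
    {B : ℕ → Set Ω} (hB : ∀ k : ℕ, MeasurableSet[ℱ (k * h)] (B k)) :
    IsStopTime ℱ (gridTime h B) := by
  intro t ht
  have e : {ω | gridTime h B ω ≤ ENNReal.ofReal t} =
      ⋃ k : ℕ, ⋃ _ : k * h ≤ t, firstAt B k := by
    ext ω
    simp only [Set.mem_ofPred_eq, Set.mem_iUnion, exists_prop]
    constructor
    · intro hω
      by_cases H : ∃ k, ω ∈ B k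
      · obtain ⟨j, hj⟩ := H
        obtain ⟨k, -, hk⟩ := exists_mem_firstAt hj
        rw [gridTime_eq hk, ENNReal.ofReal_le_ofReal_iff ht] at hω
        exact ⟨k, hω, hk⟩
      · simp [gridTime_eq_top H] at hω
    · rintro ⟨k, hkt, hk⟩
      rw [gridTime_eq hk]
      exact ENNReal.ofReal_le_ofReal hkt
  rw [e]
  exact MeasurableSet.iUnion fun k => MeasurableSet.iUnion fun hk =>
    ℱ.mono hk _ (measurableSet_firstAt hh hB k)

lemma tendsto_discPayoff {X : ℝ → Ω → ℝ} {ω : Ω} {t r : ℝ} {K c : ℝ≥0∞} (hK : K ≠ ∞) (hc : c ≠ ∞)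
    (hX : ContinuousWithinAt (fun s => X s ω) (Set.Ici t) t) :
    Tendsto (fun u => discPayoff X r K c u ω) (nhdsWithin t (Set.Ici t))
      (nhds (discPayoff X r K c t ω)) := by
  unfold discPayoff
  refine ENNReal.Tendsto.mul ?_ (Or.inr ?_) ?_ (Or.inr ENNReal.ofReal_ne_top)
  · refine (ENNReal.tendsto_ofReal (Continuous.tendsto ?_ t)).mono_left nhdsWithin_le_nhds
    fun_prop
  · exact ne_top_of_le_ne_top hK tsub_le_self
  · exact ENNReal.Tendsto.sub tendsto_const_nhds
      (ENNReal.Tendsto.const_mul (tendsto_expX hX) (Or.inr hc)) (Or.inl hK)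

section Levy

variable [m0 : MeasurableSpace Ω] {P : Measure Ω} {ℱ : Filtration ℝ m0} {X : ℝ → Ω → ℝ}
  {r : ℝ} {κ : Measure ℝ≥0∞}

lemma IsLevy.measurable_discPayoff (hX : IsLevy P ℱ X) (r : ℝ) (K c : ℝ≥0∞) {u : ℝ} (hu : 0 ≤ u) :
    Measurable (discPayoff X r K c u) := by
  have h := (hX.measurable_expX hu).mono (ℱ.le _) le_rfl
  exact (measurable_const.sub (h.const_mul c)).const_mul _

lemma IsLevy.lintegral_tsum_discPayoff (hX : IsLevy P ℱ X) (r : ℝ) (K c : ℝ≥0∞) {h : ℝ}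
    (hh : 0 ≤ h) {A : ℕ → Set Ω} (hA : ∀ k : ℕ, MeasurableSet[ℱ (k * h)] (A k)) :
    ∫⁻ ω, ∑' k : ℕ, (A k).indicator (discPayoff X r K c (k * h)) ω ∂P =
      ∑' k : ℕ, ∫⁻ ω in A k, discPayoff X r K c (k * h) ω ∂P := by
  rw [lintegral_tsum fun k => ((hX.measurable_discPayoff r K c (by positivity)).indicator
    (ℱ.le _ _ (hA k))).aemeasurable]
  exact tsum_congr fun k => lintegral_indicator (ℱ.le _ _ (hA k)) _

lemma IsLevy.lintegral_putPayoff_le (hX : IsLevy P ℱ X) (hκ : IsClock r κ)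
    (hM0 : meanInf P X κ ≠ 0) {K : ℝ} (x : ℝ) {τ : Ω → ℝ≥0∞} (hτ : IsStopTime ℱ τ) :
    ∫⁻ ω, ENNReal.ofReal (putPayoff X r K x τ ω) ∂P ≤
      excess P X κ (ENNReal.ofReal K * meanInf P X κ) (ENNReal.ofReal (Real.exp x)) /
        meanInf P X κ := by
  set K' := ENNReal.ofReal K
  set c := ENNReal.ofReal (Real.exp x) with hc
  have hM : meanInf P X κ ≠ ∞ := ne_top_of_le_ne_top ENNReal.one_ne_top (hX.meanInf_le_one hκ)
  let B : ℕ → ℕ → Set Ω := fun n k => {ω | τ ω ≤ ENNReal.ofReal (k * (2 ^ n)⁻¹)}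
  have hpos : ∀ n : ℕ, (0 : ℝ) < (2 ^ n)⁻¹ := fun n => by positivity
  have hA : ∀ n k : ℕ, MeasurableSet[ℱ (k * (2 ^ n)⁻¹)] (firstAt (B n) k) := fun n k =>
    measurableSet_firstAt (hpos n).le (fun k => hτ _ (by positivity)) k
  let p : ℕ → Ω → ℝ≥0∞ := fun n ω => ∑' k : ℕ,
    (firstAt (B n) k).indicator (discPayoff X r K' c (k * (2 ^ n)⁻¹)) ω
  have hpm : ∀ n, Measurable (p n) := fun n => Measurable.tsum fun k =>
    (hX.measurable_discPayoff r K' c (by positivity)).indicator (ℱ.le _ _ (hA n k))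
  have hpi : ∀ n, ∫⁻ ω, p n ω ∂P ≤ excess P X κ (K' * meanInf P X κ) c / meanInf P X κ := by
    intro n
    rw [ENNReal.le_div_iff_mul_le (Or.inl hM0) (Or.inl hM), mul_comm,
      hX.lintegral_tsum_discPayoff r K' c (hpos n).le (hA n)]
    exact hX.tsum_payoff_le hκ (hpos n).le (hA n) (pairwise_disjoint_firstAt _)
      (by simp [hc, Real.exp_pos]) ENNReal.ofReal_ne_top
  have hpt : ∀ ω, ENNReal.ofReal (putPayoff X r K x τ ω) ≤ liminf (fun n => p n ω) atTop := by
    intro ω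
    rw [ofReal_putPayoff]
    split_ifs with htop
    · exact zero_le
    set T := (τ ω).toReal with hT
    have hT0 : 0 ≤ T := ENNReal.toReal_nonneg
    have hτT : τ ω = ENNReal.ofReal T := (ENNReal.ofReal_toReal htop).symm
    have hlim := (tendsto_discPayoff (r := r) (K := K') (c := c) ENNReal.ofReal_ne_top
      ENNReal.ofReal_ne_top (hX.rightCont ω T hT0)).comp (tendsto_ceil_dyadic T hT0)
    change discPayoff X r K' c T ω ≤ _
    rw [← hlim.liminf_eq]
    refine liminf_le_liminf (Eventually.of_forall fun n => ?_)
    have hmem : ω ∈ firstAt (B n) ⌈T * 2 ^ n⌉₊ := by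
      constructor
      · show τ ω ≤ _
        rw [hτT]
        refine ENNReal.ofReal_le_ofReal ?_
        rw [← div_eq_mul_inv, le_div_iff₀ (by positivity)]
        exact Nat.le_ceil _
      · intro j hj hle
        have hle' : τ ω ≤ ENNReal.ofReal (j * (2 ^ n)⁻¹) := hle
        rw [hτT, ENNReal.ofReal_le_ofReal_iff (by positivity), ← div_eq_mul_inv,
          le_div_iff₀ (by positivity)] at hle'
        exact absurd (Nat.ceil_le.2 hle') (not_le.2 hj)
    exact (tsum_indicator_firstAt hmem
      (fun k : ℕ => discPayoff X r K' c (k * (2 ^ n)⁻¹))).ge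
  calc ∫⁻ ω, ENNReal.ofReal (putPayoff X r K x τ ω) ∂P
      ≤ ∫⁻ ω, liminf (fun n => p n ω) atTop ∂P := lintegral_mono hpt
    _ ≤ liminf (fun n => ∫⁻ ω, p n ω ∂P) atTop := lintegral_liminf_le hpm
    _ ≤ liminf (fun _ : ℕ => excess P X κ (K' * meanInf P X κ) c / meanInf P X κ) atTop :=
        liminf_le_liminf (Eventually.of_forall hpi)
    _ = _ := liminf_const _

lemma IsLevy.putValue_eq (hX : IsLevy P ℱ X) (hκ : IsClock r κ)
    (hM0 : meanInf P X κ ≠ 0) (K x : ℝ) :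
    putValue P ℱ X r K x =
      (excess P X κ (ENNReal.ofReal K * meanInf P X κ) (ENNReal.ofReal (Real.exp x)) /
        meanInf P X κ).toReal := by
  have := hX.isProb
  have := hκ.isProb
  set K' := ENNReal.ofReal K with hK'
  set c := ENNReal.ofReal (Real.exp x) with hc
  set M := meanInf P X κ with hMdef
  have hM : M ≠ ∞ := ne_top_of_le_ne_top ENNReal.one_ne_top (hX.meanInf_le_one hκ)
  have hK : K' ≠ ∞ := ENNReal.ofReal_ne_top
  have hc0 : c ≠ 0 := by simp [hc, Real.exp_pos]
  have hct : c ≠ ∞ := ENNReal.ofReal_ne_top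
  have hEtop : excess P X κ (K' * M) c ≠ ∞ := by
    refine ne_top_of_le_ne_top (ENNReal.mul_ne_top hK hM) ?_
    calc excess P X κ (K' * M) c ≤ ∫⁻ _, K' * M ∂(κ.prod P) :=
          lintegral_mono fun p => tsub_le_self
      _ = K' * M := by simp
  have hEM : excess P X κ (K' * M) c / M ≠ ∞ := ENNReal.div_ne_top hEtop hM0
  have hupper : ∀ τ : {τ : Ω → ℝ≥0∞ // IsStopTime ℱ τ},
      ∫ ω, putPayoff X r K x τ.1 ω ∂P ≤ (excess P X κ (K' * M) c / M).toReal := by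
    intro τ
    by_cases hm : AEStronglyMeasurable (putPayoff X r K x τ.1) P
    · rw [integral_eq_lintegral_of_nonneg_ae
        (Eventually.of_forall (putPayoff_nonneg X r x K τ.1)) hm]
      exact ENNReal.toReal_mono hEM (hX.lintegral_putPayoff_le hκ hM0 x τ.2)
    · rw [integral_undef fun h => hm h.aestronglyMeasurable]
      exact ENNReal.toReal_nonneg
  have : Nonempty {τ : Ω → ℝ≥0∞ // IsStopTime ℱ τ} :=
    ⟨⟨fun _ => ∞, fun t _ => by simp⟩⟩
  have hbdd : BddAbove (Set.range fun τ : {τ : Ω → ℝ≥0∞ // IsStopTime ℱ τ} =>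
      ∫ ω, putPayoff X r K x τ.1 ω ∂P) := ⟨_, Set.forall_mem_range.2 hupper⟩
  refine le_antisymm (ciSup_le hupper) ?_
  have hstep : ∀ n : ℕ, ∫⁻ p, (K' * M - c * gridInf X (2 ^ n)⁻¹ (4 ^ n) 0 p.1 p.2) ∂(κ.prod P) ≤
      M * ENNReal.ofReal (putValue P ℱ X r K x) := by
    intro n
    set h : ℝ := (2 ^ n)⁻¹ with hh
    have hh0 : 0 ≤ h := by positivity
    let B : ℕ → Set Ω := fun k => {ω | c * expX X (k * h) ω < K' * M}
    have hB : ∀ k : ℕ, MeasurableSet[ℱ (k * h)] (B k) := fun k =>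
      measurableSet_lt ((hX.measurable_expX (by positivity)).const_mul c)
        (@measurable_const _ _ _ (ℱ (k * h)) _)
    have hA := measurableSet_firstAt hh0 hB
    refine (hX.le_tsum_payoff hκ hK hc0 hct h hh0 (4 ^ n) (A := firstAt B) rfl).trans ?_
    gcongr
    refine (hX.lintegral_tsum_discPayoff r K' c hh0 hA).ge.trans ?_
    simp only [hK', hc, ← ofReal_putPayoff_gridTime X r x hh0]
    have hm : Measurable fun ω => ENNReal.ofReal (putPayoff X r K x (gridTime h B) ω) := by
      simp only [ofReal_putPayoff_gridTime X r x hh0]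
      exact Measurable.tsum fun k =>
        (hX.measurable_discPayoff r K' c (by positivity)).indicator (ℱ.le _ _ (hA k))
    have hm' : Measurable (putPayoff X r K x (gridTime h B)) := by
      have := hm.ennreal_toReal
      simpa only [ENNReal.toReal_ofReal (putPayoff_nonneg X r x K _ _)] using this
    have hle := hX.lintegral_putPayoff_le hκ hM0 (K := K) x (isStopTime_gridTime hh0 hB)
    rw [← ENNReal.ofReal_toReal (ne_top_of_le_ne_top hEM hle)]
    refine ENNReal.ofReal_le_ofReal ?_
    rw [← integral_eq_lintegral_of_nonneg_ae
      (Eventually.of_forall (putPayoff_nonneg X r x K _)) hm'.aestronglyMeasurable]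
    exact le_ciSup hbdd ⟨gridTime h B, isStopTime_gridTime hh0 hB⟩
  have hsup : excess P X κ (K' * M) c ≤ M * ENNReal.ofReal (putValue P ℱ X r K x) := by
    rw [excess]
    simp only [fun p : ℝ≥0∞ × Ω => expInf_eq_iInf_gridInf le_rfl p.1 (hX.rightCont p.2),
      sub_mul_iInf hc0 hct]
    rw [lintegral_iSup]
    · exact iSup_le hstep
    · exact fun n => measurable_const.sub
        ((hX.measurable_gridInf (by positivity) (4 ^ n) le_rfl).const_mul c)
    · intro i j hij p
      have := antitone_gridInf X 0 p.1 p.2 hij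
      dsimp only at this ⊢
      gcongr
  have hv0 : 0 ≤ putValue P ℱ X r K x :=
    Real.iSup_nonneg fun τ => integral_nonneg fun ω => putPayoff_nonneg X r x K τ.1 ω
  rw [← ENNReal.toReal_ofReal hv0]
  refine ENNReal.toReal_mono ENNReal.ofReal_ne_top ?_
  rw [ENNReal.div_le_iff_le_mul (Or.inl hM0) (Or.inl hM)]
  exact hsup.trans_eq (mul_comm _ _)

end Levy

lemma lintegral_expMeasure_map {r : ℝ} {F : ℝ≥0∞ → ℝ≥0∞} (hF : Measurable F) :
    ∫⁻ s, F s ∂((expMeasure r).map ENNReal.ofReal) =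
      ∫⁻ u, exponentialPDF r u * F (ENNReal.ofReal u) := by
  have hm : Measurable fun u : ℝ => F (ENNReal.ofReal u) := hF.comp ENNReal.measurable_ofReal
  have hd : Measurable (exponentialPDF r) := (measurable_exponentialPDFReal r).ennreal_ofReal
  rw [lintegral_map hF ENNReal.measurable_ofReal]
  exact lintegral_withDensity_eq_lintegral_mul volume hd hm

lemma setLIntegral_expMeasure_map {r : ℝ} {F : ℝ≥0∞ → ℝ≥0∞} (hF : Measurable F) :
    ∫⁻ s, F s ∂((expMeasure r).map ENNReal.ofReal) =
      ∫⁻ u in Set.Ioi (0 : ℝ), ENNReal.ofReal (r * Real.exp (-(r * u))) * F (ENNReal.ofReal u) := by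
  rw [lintegral_expMeasure_map hF, ← lintegral_indicator measurableSet_Ioi]
  refine lintegral_congr_ae ?_
  filter_upwards [Measure.ae_ne volume (0 : ℝ)] with u hu
  rcases lt_or_gt_of_ne hu with h | h
  · rw [Set.indicator_of_notMem (by simpa using h.le), exponentialPDF_of_neg h, zero_mul]
  · rw [Set.indicator_of_mem (Set.mem_Ioi.2 h), exponentialPDF_of_nonneg h.le]

lemma isClock_expMeasure_map {r : ℝ} (hr : 0 < r) :
    IsClock r ((expMeasure r).map ENNReal.ofReal) where
  isProb := by
    have := isProbabilityMeasure_expMeasure hr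
    exact Measure.isProbabilityMeasure_map ENNReal.measurable_ofReal.aemeasurable
  pos := by
    have hd : Measurable (exponentialPDF r) := (measurable_exponentialPDFReal r).ennreal_ofReal
    refine (ae_map_iff ENNReal.measurable_ofReal.aemeasurable measurableSet_Ioi).2 ?_
    refine (ae_withDensity_iff hd).2 ?_
    filter_upwards [Measure.ae_ne volume (0 : ℝ)] with u hu hne
    refine ENNReal.ofReal_pos.2 (lt_of_le_of_ne (le_of_not_gt fun h => hne ?_) hu.symm)
    exact exponentialPDF_of_neg h
  memoryless := by
    intro t ht F hF hF0
    rw [lintegral_expMeasure_map hF,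
      lintegral_expMeasure_map (F := fun s => F (s - ENNReal.ofReal t))
        (hF.comp (measurable_id.sub measurable_const)),
      ← lintegral_const_mul' _ _ ENNReal.ofReal_ne_top,
      ← lintegral_add_right_eq_self _ t]
    refine lintegral_congr fun v => ?_
    rcases lt_or_ge v 0 with hv | hv
    · rw [exponentialPDF_of_neg hv, tsub_eq_zero_of_le (ENNReal.ofReal_le_ofReal (by linarith)),
        hF0]
      simp
    · rw [exponentialPDF_of_nonneg hv, exponentialPDF_of_nonneg (by positivity),
        ENNReal.ofReal_add hv ht, ENNReal.add_sub_cancel_right ENNReal.ofReal_ne_top, ← mul_assoc,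
        ← ENNReal.ofReal_mul (Real.exp_pos _).le]
      congr 2
      rw [mul_left_comm, ← Real.exp_add]
      ring_nf

lemma isClock_dirac_top : IsClock 0 (Measure.dirac (∞ : ℝ≥0∞)) where
  isProb := inferInstance
  pos := by simp
  memoryless := by
    intro t ht F hF hF0
    rw [lintegral_dirac' _ hF,
      lintegral_dirac' (f := fun s => F (s - ENNReal.ofReal t)) _
        (hF.comp (measurable_id.sub measurable_const))]
    simp

/-- The infimum of `e^{X_u}` over the closed interval `[0, t]`. -/
def closedInf (X : ℝ → Ω → ℝ) (t : ℝ) (ω : Ω) : ℝ≥0∞ := ⨅ u ∈ Set.Icc 0 t, expX X u ω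

lemma antitone_closedInf (X : ℝ → Ω → ℝ) (ω : Ω) : Antitone fun t => closedInf X t ω :=
  fun _ _ h => biInf_mono fun _ hu => ⟨hu.1, hu.2.trans h⟩

lemma closedInf_le_expInf (X : ℝ → Ω → ℝ) (t : ℝ) (ω : Ω) :
    closedInf X t ω ≤ expInf X 0 (ENNReal.ofReal t) ω := by
  refine le_iInf fun u => le_iInf fun hu => le_iInf fun hut => ?_
  rw [zero_add]
  exact iInf₂_le u ⟨hu, ((ENNReal.ofReal_lt_ofReal_iff_of_nonneg hu).1 hut).le⟩

lemma expInf_le_closedInf (X : ℝ → Ω → ℝ) {s t : ℝ} (ht : 0 < t) (hst : s < t) (ω : Ω) :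
    expInf X 0 (ENNReal.ofReal t) ω ≤ closedInf X s ω := by
  refine le_iInf₂ fun u hu => ?_
  have := expInf_le (X := X) (t := 0) (ω := ω) hu.1
    ((ENNReal.ofReal_lt_ofReal_iff ht).2 (hu.2.trans_lt hst))
  rwa [zero_add] at this

lemma closedInf_eq_min (X : ℝ → Ω → ℝ) {t : ℝ} (ht : 0 ≤ t) (ω : Ω) :
    closedInf X t ω = min (expInf X 0 (ENNReal.ofReal t) ω) (expX X t ω) := by
  refine le_antisymm (le_min (closedInf_le_expInf X t ω) (iInf₂_le t ⟨ht, le_rfl⟩)) ?_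
  refine le_iInf₂ fun u hu => ?_
  rcases hu.2.lt_or_eq with h | rfl
  · refine min_le_of_left_le ?_
    have := expInf_le (X := X) (t := 0) (ω := ω) hu.1
      ((ENNReal.ofReal_lt_ofReal_iff_of_nonneg hu.1).2 h)
    rwa [zero_add] at this
  · exact min_le_right _ _

lemma ofReal_exp_sInf {X : ℝ → Ω → ℝ} {ω : Ω} {S : Set ℝ} (hS : S.Nonempty)
    (hb : BddBelow ((fun s => X s ω) '' S)) :
    ENNReal.ofReal (Real.exp (sInf ((fun s => X s ω) '' S))) = ⨅ u ∈ S, expX X u ω := by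
  have h := Monotone.map_csInf_of_continuousAt (f := fun x => ENNReal.ofReal (Real.exp x))
    (A := (fun s => X s ω) '' S)
    (ENNReal.continuous_ofReal.comp Real.continuous_exp).continuousAt
    (fun a b hab => ENNReal.ofReal_le_ofReal (Real.exp_le_exp.2 hab)) (hS.image _) hb
  rw [h, Set.image_image, sInf_image]
  rfl

lemma ae_lintegral_expInf_eq [MeasurableSpace Ω] (P : Measure Ω) (X : ℝ → Ω → ℝ)
    {g : ℝ≥0∞ → ℝ≥0∞} (hg : Monotone g) :
    ∀ᵐ t ∂(volume.restrict (Set.Ioi (0 : ℝ))),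
      ∫⁻ ω, g (expInf X 0 (ENNReal.ofReal t) ω) ∂P = ∫⁻ ω, g (closedInf X t ω) ∂P := by
  have hanti : Antitone fun t => ∫⁻ ω, g (closedInf X t ω) ∂P := fun s t h =>
    lintegral_mono fun ω => hg (antitone_closedInf X ω h)
  have hc := hanti.countable_not_continuousAt.ae_notMem (volume.restrict (Set.Ioi (0 : ℝ)))
  filter_upwards [hc, ae_restrict_mem measurableSet_Ioi] with t ht ht0
  have ht' : ContinuousAt (fun t => ∫⁻ ω, g (closedInf X t ω) ∂P) t := by simpa using ht
  refine le_antisymm ?_ (lintegral_mono fun ω => hg (closedInf_le_expInf X t ω))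
  refine ge_of_tendsto (ht'.tendsto.mono_left (nhdsWithin_le_nhds (s := Set.Iio t))) ?_
  filter_upwards [self_mem_nhdsWithin] with s hs
  exact lintegral_mono fun ω => hg (expInf_le_closedInf X ht0 hs ω)

lemma lintegral_indicator_Ici {α : Type*} [MeasurableSpace α] (μ : Measure α) {f : α → ℝ≥0∞}
    (hf : Measurable f) : ∫⁻ a, (Set.Ici 1).indicator 1 (f a) ∂μ = μ {a | 1 ≤ f a} :=
  lintegral_indicator_one (hf measurableSet_Ici)

lemma monotone_indicator_Ici : Monotone ((Set.Ici (1 : ℝ≥0∞)).indicator (1 : ℝ≥0∞ → ℝ≥0∞)) := by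
  intro a b hab
  by_cases ha : a ∈ Set.Ici (1 : ℝ≥0∞)
  · rw [Set.indicator_of_mem ha, Set.indicator_of_mem (Set.mem_Ici.2 (le_trans ha hab))]
    rfl
  · rw [Set.indicator_of_notMem ha]
    exact zero_le

lemma one_le_ofReal_exp_iff {y : ℝ} (h : ENNReal.ofReal (Real.exp y) ≤ 1) :
    1 ≤ ENNReal.ofReal (Real.exp y) ↔ y = 0 := by
  rw [ENNReal.ofReal_le_one, Real.exp_le_one_iff] at h
  rw [ENNReal.one_le_ofReal, Real.one_le_exp_iff]
  exact ⟨fun h' => le_antisymm h h', fun h' => h'.ge⟩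

lemma expInf_ne_zero_of_forall_le {s : ℝ≥0∞} {ω : Ω} {b : ℝ}
    (hb : ∀ u, 0 ≤ u → ENNReal.ofReal u < s → b ≤ X u ω) : expInf X 0 s ω ≠ 0 := by
  have : ENNReal.ofReal (Real.exp b) ≤ expInf X 0 s ω :=
    le_iInf fun u => le_iInf fun hu => le_iInf fun hus => by
      rw [zero_add]
      exact ENNReal.ofReal_le_ofReal (Real.exp_le_exp.2 (hb u hu hus))
  exact ((ENNReal.ofReal_pos.2 (Real.exp_pos b)).trans_le this).ne'

lemma expInf_top_eq (X : ℝ → Ω → ℝ) (ω : Ω) : expInf X 0 ∞ ω = ⨅ u ∈ Set.Ici 0, expX X u ω := by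
  simp [expInf]

lemma ofReal_exp_infAll {ω : Ω} (h : expInf X 0 ∞ ω ≠ 0) :
    ENNReal.ofReal (Real.exp (infAll X ω)) = expInf X 0 ∞ ω := by
  rw [expInf_top_eq] at h ⊢
  refine ofReal_exp_sInf Set.nonempty_Ici ⟨Real.log (⨅ u ∈ Set.Ici 0, expX X u ω).toReal, ?_⟩
  refine Set.forall_mem_image.2 fun u hu => ?_
  have hle : ⨅ u ∈ Set.Ici 0, expX X u ω ≤ expX X u ω := iInf₂_le u hu
  have hfin := ne_top_of_le_ne_top (expX_ne_top X u ω) hle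
  rw [Real.log_le_iff_le_exp (ENNReal.toReal_pos h hfin)]
  exact (ENNReal.le_ofReal_iff_toReal_le hfin (Real.exp_pos _).le).1 hle

section Levy

variable [m0 : MeasurableSpace Ω] {P : Measure Ω} {ℱ : Filtration ℝ m0} {X : ℝ → Ω → ℝ}
  {r : ℝ} {κ : Measure ℝ≥0∞}

lemma IsLevy.bddBelow_image_Icc (hX : IsLevy P ℱ X) (ω : Ω) (t : ℝ) :
    BddBelow ((fun s => X s ω) '' Set.Icc 0 t) := by
  refine isCompact_Icc.induction_on (p := fun S => BddBelow ((fun s => X s ω) '' S)) (by simp)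
    (fun S T h hT => hT.mono (Set.image_mono h))
    (fun S T hS hT => by rw [Set.image_union]; exact hS.union hT) fun u hu => ?_
  have hR : ∀ᶠ s in nhdsWithin u (Set.Ici u), X u ω - 1 ≤ X s ω :=
    (hX.rightCont ω u hu.1).eventually (le_mem_nhds (by linarith))
  have hL : ∃ b, ∀ᶠ s in nhdsWithin u (Set.Icc 0 t), b ≤ X s ω := by
    rcases hu.1.eq_or_lt with rfl | h0
    · exact ⟨_, hR.filter_mono (nhdsWithin_mono _ fun s hs => hs.1)⟩
    · obtain ⟨l, hl⟩ := hX.leftLim ω u h0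
      refine ⟨min (l - 1) (X u ω - 1), Eventually.filter_mono nhdsWithin_le_nhds ?_⟩
      rw [← nhdsLT_sup_nhdsGE, eventually_sup]
      exact ⟨(hl.eventually (le_mem_nhds (by linarith))).mono fun s => min_le_of_left_le,
        hR.mono fun s => min_le_of_right_le⟩
  obtain ⟨b, hb⟩ := hL
  exact ⟨_, hb, ⟨b, Set.forall_mem_image.2 fun s hs => hs⟩⟩

lemma IsLevy.ofReal_exp_runInf (hX : IsLevy P ℱ X) {t : ℝ} (ht : 0 ≤ t) (ω : Ω) :
    ENNReal.ofReal (Real.exp (runInf X t ω)) = closedInf X t ω :=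
  ofReal_exp_sInf (Set.nonempty_Icc.2 ht) (hX.bddBelow_image_Icc ω t)

lemma IsLevy.measurable_closedInf (hX : IsLevy P ℱ X) {t : ℝ} (ht : 0 ≤ t) :
    Measurable (closedInf X t) := by
  have h : closedInf X t = fun ω => min (expInf X 0 (ENNReal.ofReal t) ω) (expX X t ω) :=
    funext fun ω => closedInf_eq_min X ht ω
  rw [h]
  exact (hX.measurable_expInf_apply le_rfl _).min ((hX.measurable_expX ht).mono (ℱ.le _) le_rfl)

lemma IsLevy.closedInf_le_one (hX : IsLevy P ℱ X) {t : ℝ} (ht : 0 ≤ t) :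
    ∀ᵐ ω ∂P, closedInf X t ω ≤ 1 := by
  filter_upwards [hX.expX_zero] with ω hω
  exact hω ▸ iInf₂_le 0 ⟨le_rfl, ht⟩

/-- Mixing over an exponential clock does not distinguish open from closed intervals. -/
lemma IsLevy.integral_closedInf (hX : IsLevy P ℱ X) (hr : 0 < r) {g : ℝ≥0∞ → ℝ≥0∞}
    (hg : Monotone g) (hg1 : g 1 ≠ ∞) :
    ∫ t in Set.Ioi (0 : ℝ), r * Real.exp (-(r * t)) * (∫⁻ ω, g (closedInf X t ω) ∂P).toReal =
      (∫⁻ p, g (expInf X 0 p.1 p.2) ∂(((expMeasure r).map ENNReal.ofReal).prod P)).toReal := by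
  have := hX.isProb
  have := (isClock_expMeasure_map hr).isProb
  have hm : Measurable fun p : ℝ≥0∞ × Ω => g (expInf X 0 p.1 p.2) :=
    hg.measurable.comp (hX.measurable_expInf le_rfl)
  have hanti : Antitone fun t => ∫⁻ ω, g (closedInf X t ω) ∂P := fun s t h =>
    lintegral_mono fun ω => hg (antitone_closedInf X ω h)
  have hfin : ∀ t ∈ Set.Ioi (0 : ℝ), ∫⁻ ω, g (closedInf X t ω) ∂P < ∞ := fun t ht =>
    calc ∫⁻ ω, g (closedInf X t ω) ∂P ≤ ∫⁻ _, g 1 ∂P :=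
          lintegral_mono_ae ((hX.closedInf_le_one (le_of_lt ht)).mono fun ω hω => hg hω)
      _ < ∞ := by simpa using hg1.lt_top
  have hd : Measurable fun t : ℝ => ENNReal.ofReal (r * Real.exp (-(r * t))) := by fun_prop
  calc ∫ t in Set.Ioi (0 : ℝ), r * Real.exp (-(r * t)) * (∫⁻ ω, g (closedInf X t ω) ∂P).toReal
      = ∫ t in Set.Ioi (0 : ℝ), (ENNReal.ofReal (r * Real.exp (-(r * t))) *
          ∫⁻ ω, g (closedInf X t ω) ∂P).toReal := by
        refine integral_congr_ae (Eventually.of_forall fun t => ?_)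
        dsimp only
        rw [ENNReal.toReal_mul, ENNReal.toReal_ofReal (by positivity)]
    _ = (∫⁻ t in Set.Ioi (0 : ℝ), ENNReal.ofReal (r * Real.exp (-(r * t))) *
          ∫⁻ ω, g (closedInf X t ω) ∂P).toReal := by
        refine integral_toReal (hd.mul hanti.measurable).aemeasurable ?_
        filter_upwards [ae_restrict_mem measurableSet_Ioi] with t ht
        exact ENNReal.mul_lt_top ENNReal.ofReal_lt_top (hfin t ht)
    _ = _ := by
        rw [lintegral_prod _ hm.aemeasurable,
          setLIntegral_expMeasure_map hm.lintegral_prod_right']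
        congr 1
        refine lintegral_congr_ae ?_
        filter_upwards [ae_lintegral_expInf_eq P X hg] with t ht
        rw [← ht]

lemma IsLevy.integral_exp_runInf (hX : IsLevy P ℱ X) {t : ℝ} (ht : 0 ≤ t) :
    ∫ ω, Real.exp (runInf X t ω) ∂P = (∫⁻ ω, closedInf X t ω ∂P).toReal := by
  rw [← integral_toReal (hX.measurable_closedInf ht).aemeasurable
    ((hX.closedInf_le_one ht).mono fun ω h => h.trans_lt ENNReal.one_lt_top)]
  simp only [← hX.ofReal_exp_runInf ht, ENNReal.toReal_ofReal (Real.exp_pos _).le]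

lemma IsLevy.measure_runInf_eq_zero (hX : IsLevy P ℱ X) {t : ℝ} (ht : 0 ≤ t) :
    P {ω | runInf X t ω = 0} = ∫⁻ ω, (Set.Ici 1).indicator 1 (closedInf X t ω) ∂P := by
  rw [lintegral_indicator_Ici P (hX.measurable_closedInf ht)]
  refine measure_congr ?_
  filter_upwards [hX.closedInf_le_one ht] with ω hω
  rw [← hX.ofReal_exp_runInf ht] at hω
  refine propext (Iff.trans (one_le_ofReal_exp_iff hω).symm ?_)
  rw [hX.ofReal_exp_runInf ht]
  rfl

lemma IsLevy.expInf_ne_zero (hX : IsLevy P ℱ X) {s : ℝ≥0∞} (hs : s ≠ ∞) (ω : Ω) :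
    expInf X 0 s ω ≠ 0 := by
  obtain ⟨b, hb⟩ := hX.bddBelow_image_Icc ω s.toReal
  refine expInf_ne_zero_of_forall_le (b := b) fun u hu hus => hb ⟨u, ⟨hu, ?_⟩, rfl⟩
  exact (ENNReal.ofReal_le_iff_le_toReal hs).1 hus.le

lemma IsLevy.expInf_top_ne_zero (hX : IsLevy P ℱ X) {ω : Ω}
    (h : Tendsto (fun t => X t ω) atTop atTop) : expInf X 0 ∞ ω ≠ 0 := by
  obtain ⟨N, hN⟩ := eventually_atTop.1 (h.eventually_ge_atTop 0)
  obtain ⟨b, hb⟩ := hX.bddBelow_image_Icc ω N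
  refine expInf_ne_zero_of_forall_le (b := min b 0) fun u hu _ => ?_
  rcases le_total u N with hu' | hu'
  · exact min_le_of_left_le (hb ⟨u, ⟨hu, hu'⟩, rfl⟩)
  · exact min_le_of_right_le (hN u hu')

lemma IsLevy.meanInf_ne_zero (hX : IsLevy P ℱ X) [NeZero (κ.prod P)]
    (h : ∀ᵐ p ∂(κ.prod P), expInf X 0 p.1 p.2 ≠ 0) : meanInf P X κ ≠ 0 := by
  rw [meanInf, Ne, lintegral_eq_zero_iff (hX.measurable_expInf le_rfl)]
  intro h0
  obtain ⟨p, h1, h2⟩ := (h.and h0).exists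
  exact h1 h2

lemma IsLevy.exists_isClock (hX : IsLevy P ℱ X)
    (hr : 0 < r ∨ (r = 0 ∧ P {ω | Tendsto (fun t => X t ω) atTop atTop} = 1)) :
    ∃ κ, IsClock r κ ∧ meanInf P X κ ≠ 0 ∧ mInf P X r = (meanInf P X κ).toReal ∧
      atomZeroProb P X r = ((κ.prod P) {p | 1 ≤ expInf X 0 p.1 p.2}).toReal := by
  have := hX.isProb
  rcases hr with hr | ⟨rfl, hlim⟩
  · have hκ := isClock_expMeasure_map hr
    have := hκ.isProb
    refine ⟨_, hκ, hX.meanInf_ne_zero ?_, ?_, ?_⟩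
    · have hfin : ∀ᵐ s ∂((expMeasure r).map ENNReal.ofReal), s ≠ ∞ :=
        (ae_map_iff ENNReal.measurable_ofReal.aemeasurable
          (measurableSet_singleton (∞ : ℝ≥0∞)).compl).2 (by simp)
      filter_upwards [Measure.quasiMeasurePreserving_fst.ae hfin] with p hp
      exact hX.expInf_ne_zero hp p.2
    · rw [mInf, if_pos hr]
      refine Eq.trans ?_ (hX.integral_closedInf hr (g := id) monotone_id ENNReal.one_ne_top)
      refine setIntegral_congr_fun measurableSet_Ioi fun t ht => ?_
      simp only [hX.integral_exp_runInf (le_of_lt ht), id]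
    · rw [atomZeroProb, if_pos hr, ← lintegral_indicator_Ici _ (hX.measurable_expInf le_rfl),
        ← hX.integral_closedInf hr monotone_indicator_Ici (by simp)]
      refine setIntegral_congr_fun measurableSet_Ioi fun t ht => ?_
      simp only [hX.measure_runInf_eq_zero (le_of_lt ht)]
  · have hm := hX.measurable_expInf_apply le_rfl (∞ : ℝ≥0∞)
    have hS : ∀ᵐ ω ∂P, expInf X 0 ∞ ω ≠ 0 := by
      have hms : MeasurableSet {ω | expInf X 0 ∞ ω ≠ 0} := hm (measurableSet_singleton 0).compl
      refine (prob_compl_eq_zero_iff hms).2 (le_antisymm prob_le_one ?_)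
      rw [← hlim]
      exact measure_mono fun ω hω => hX.expInf_top_ne_zero hω
    have hdirac : ((Measure.dirac (∞ : ℝ≥0∞)).prod P) = P.map (Prod.mk ∞) :=
      Measure.dirac_prod _
    have hinf : ∀ᵐ ω ∂P, ENNReal.ofReal (Real.exp (infAll X ω)) = expInf X 0 ∞ ω :=
      hS.mono fun ω h => ofReal_exp_infAll h
    have hle : ∀ᵐ ω ∂P, expInf X 0 ∞ ω ≤ 1 := by
      filter_upwards [hX.expX_zero] with ω hω
      rw [← hω, expInf_top_eq]
      exact iInf₂_le 0 Set.self_mem_Ici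
    have hmi := hX.measurable_expInf (le_refl 0)
    refine ⟨_, isClock_dirac_top, hX.meanInf_ne_zero ?_, ?_, ?_⟩
    · rw [hdirac]
      exact (ae_map_iff measurable_prodMk_left.aemeasurable
        (hmi (measurableSet_singleton 0).compl)).2 hS
    · rw [mInf, if_neg (lt_irrefl 0), meanInf, hdirac, lintegral_map hmi measurable_prodMk_left,
        ← integral_toReal hm.aemeasurable (hle.mono fun ω h => h.trans_lt ENNReal.one_lt_top)]
      refine integral_congr_ae (hinf.mono fun ω h => ?_)
      simp only [← h, ENNReal.toReal_ofReal (Real.exp_pos _).le]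
    · rw [atomZeroProb, if_neg (lt_irrefl 0), hdirac,
        Measure.map_apply measurable_prodMk_left (measurableSet_le measurable_const hmi)]
      congr 1
      refine measure_congr ?_
      filter_upwards [hinf, hle] with ω h h1
      rw [← h] at h1
      refine propext (Iff.trans (one_le_ofReal_exp_iff h1).symm ?_)
      rw [h]
      rfl

end Levy

lemma abs_slope_max_le {J a x : ℝ} (h0 : 0 ≤ J) (h1 : J ≤ 1) (hx : a < x) (hx1 : x < a + 1) :
    |(x - a)⁻¹ * (max (Real.exp a - Real.exp x * J) 0 - max (Real.exp a - Real.exp a * J) 0)| ≤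
      Real.exp (a + 1) := by
  have hxa : 0 < x - a := sub_pos.2 hx
  rw [abs_mul, abs_of_pos (inv_pos.2 hxa), inv_mul_le_iff₀ hxa]
  have hexp : Real.exp a ≤ Real.exp x := Real.exp_le_exp.2 hx.le
  have hexp1 : Real.exp x ≤ Real.exp (a + 1) := Real.exp_le_exp.2 hx1.le
  have hconv : Real.exp x - Real.exp a ≤ Real.exp x * (x - a) := by
    have h := mul_le_mul_of_nonneg_left (Real.add_one_le_exp (a - x)) (Real.exp_pos x).le
    rw [← Real.exp_add, add_sub_cancel] at h
    linarith
  calc |max (Real.exp a - Real.exp x * J) 0 - max (Real.exp a - Real.exp a * J) 0|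
      ≤ |(Real.exp a - Real.exp x * J) - (Real.exp a - Real.exp a * J)| :=
        abs_max_sub_max_le_abs _ _ _
    _ = (Real.exp x - Real.exp a) * J := by
        rw [abs_sub_comm, ← abs_of_nonneg (mul_nonneg (sub_nonneg.2 hexp) h0)]
        ring_nf
    _ ≤ Real.exp x - Real.exp a := mul_le_of_le_one_right (sub_nonneg.2 hexp) h1
    _ ≤ (x - a) * Real.exp (a + 1) := by nlinarith

lemma tendsto_slope_max {J : ℝ} (h1 : J ≤ 1) (a : ℝ) :
    Tendsto (fun x => (x - a)⁻¹ *
        (max (Real.exp a - Real.exp x * J) 0 - max (Real.exp a - Real.exp a * J) 0))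
      (nhdsWithin a (Set.Ioi a))
      (nhds (Real.exp a * ((Set.Ici 1).indicator 1 J - J))) := by
  rcases h1.lt_or_eq with h | rfl
  · have hd : HasDerivAt (fun x => Real.exp a - Real.exp x * J) (-(Real.exp a * J)) a :=
      ((Real.hasDerivAt_exp a).mul_const J).const_sub _
    have hpos : 0 < Real.exp a - Real.exp a * J := by nlinarith [Real.exp_pos a]
    have hev : (fun x => max (Real.exp a - Real.exp x * J) 0) =ᶠ[nhds a]
        fun x => Real.exp a - Real.exp x * J :=
      (hd.continuousAt.eventually (lt_mem_nhds hpos)).mono fun x hx => max_eq_left (le_of_lt hx)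
    have ht := (hd.congr_of_eventuallyEq hev).hasDerivWithinAt (s := Set.Ioi a)
    rw [hasDerivWithinAt_iff_tendsto_slope' (by simp)] at ht
    rw [Set.indicator_of_notMem (by simpa using h), zero_sub, mul_neg]
    exact ht
  · rw [Set.indicator_of_mem Set.self_mem_Ici]
    refine Tendsto.congr' ?_ (by simpa using tendsto_const_nhds)
    filter_upwards [self_mem_nhdsWithin] with x hx
    have : Real.exp a ≤ Real.exp x := Real.exp_le_exp.2 (le_of_lt hx)
    simp [this]

lemma hasDerivWithinAt_integral_max {α : Type*} [MeasurableSpace α] {μ : Measure α}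
    [IsFiniteMeasure μ] {J : α → ℝ} (hJ : Measurable J) (h0 : ∀ᵐ p ∂μ, 0 ≤ J p)
    (h1 : ∀ᵐ p ∂μ, J p ≤ 1) (a : ℝ) :
    HasDerivWithinAt (fun x => ∫ p, max (Real.exp a - Real.exp x * J p) 0 ∂μ)
      (Real.exp a * (μ.real {p | 1 ≤ J p} - ∫ p, J p ∂μ)) (Set.Ici a) a := by
  have hm : ∀ x, Measurable fun p => max (Real.exp a - Real.exp x * J p) 0 := fun x => by fun_prop
  have hint : ∀ x, Integrable (fun p => max (Real.exp a - Real.exp x * J p) 0) μ := fun x => by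
    refine Integrable.of_bound (hm x).aestronglyMeasurable (Real.exp a) ?_
    filter_upwards [h0] with p hp
    rw [Real.norm_of_nonneg (le_max_right _ _)]
    exact max_le (by nlinarith [mul_nonneg (Real.exp_pos x).le hp]) (Real.exp_pos a).le
  have hJi : Integrable J μ := by
    refine Integrable.of_bound hJ.aestronglyMeasurable 1 ?_
    filter_upwards [h0, h1] with p hp hp1
    rwa [Real.norm_of_nonneg hp]
  have hind : Integrable (fun p => (Set.Ici (1 : ℝ)).indicator (1 : ℝ → ℝ) (J p)) μ :=
    (integrable_const (1 : ℝ)).indicator (hJ measurableSet_Ici)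
  have hlim : ∫ p, Real.exp a * ((Set.Ici 1).indicator 1 (J p) - J p) ∂μ =
      Real.exp a * (μ.real {p | 1 ≤ J p} - ∫ p, J p ∂μ) := by
    rw [integral_const_mul, integral_sub hind hJi]
    congr 2
    exact integral_indicator_one (hJ measurableSet_Ici)
  rw [← hasDerivWithinAt_Ioi_iff_Ici, hasDerivWithinAt_iff_tendsto_slope' (by simp), ← hlim]
  have hslope : ∀ x, slope (fun x => ∫ p, max (Real.exp a - Real.exp x * J p) 0 ∂μ) a x =
      ∫ p, (x - a)⁻¹ *
        (max (Real.exp a - Real.exp x * J p) 0 - max (Real.exp a - Real.exp a * J p) 0) ∂μ := by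
    intro x
    rw [integral_const_mul, integral_sub (hint x) (hint a)]
    rfl
  rw [funext hslope]
  refine tendsto_integral_filter_of_dominated_convergence (fun _ => Real.exp (a + 1))
    (Eventually.of_forall fun x => by fun_prop) ?_ (integrable_const _) ?_
  · filter_upwards [Ioo_mem_nhdsGT (lt_add_one a)] with x hx
    filter_upwards [h0, h1] with p hp hp1
    exact abs_slope_max_le hp hp1 hx.1 hx.2
  · filter_upwards [h1] with p hp1
    exact tendsto_slope_max hp1 a

theorem stmt12 [m0 : MeasurableSpace Ω] (P : Measure Ω) (ℱ : Filtration ℝ m0)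
    (X : ℝ → Ω → ℝ) (hX : IsLevy P ℱ X) (r K : ℝ) (hK : 0 < K)
    (hr : 0 < r ∨ (r = 0 ∧ P {ω | Tendsto (fun t => X t ω) atTop atTop} = 1)) :
    HasDerivWithinAt (fun x => putValue P ℱ X r K x)
      (-Real.exp (Real.log (K * mInf P X r)) + K * atomZeroProb P X r)
      (Set.Ici (Real.log (K * mInf P X r))) (Real.log (K * mInf P X r)) := by
  have := hX.isProb
  obtain ⟨κ, hκ, hM0, hm, hq⟩ := hX.exists_isClock hr
  have := hκ.isProb
  have hM : meanInf P X κ ≠ ∞ := ne_top_of_le_ne_top ENNReal.one_ne_top (hX.meanInf_le_one hκ)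
  have hE := hX.measurable_expInf (le_refl 0)
  have hE1 := hX.expInf_le_one hκ
  set m := mInf P X r with hmdef
  have hm0 : 0 < m := hm ▸ ENNReal.toReal_pos hM0 hM
  set a := Real.log (K * m) with ha
  have hea : Real.exp a = K * m := Real.exp_log (mul_pos hK hm0)
  set J : ℝ≥0∞ × Ω → ℝ := fun p => (expInf X 0 p.1 p.2).toReal with hJ
  have hint : ∫ p, J p ∂(κ.prod P) = m := by
    rw [hm, meanInf]
    exact integral_toReal hE.aemeasurable (hE1.mono fun p h => h.trans_lt ENNReal.one_lt_top)
  have hatom : (κ.prod P).real {p | 1 ≤ J p} = atomZeroProb P X r := by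
    rw [hq, Measure.real]
    congr 1
    refine measure_congr ?_
    filter_upwards [hE1] with p hp
    have h := ENNReal.ofReal_le_iff_le_toReal (a := 1) (ne_top_of_le_ne_top ENNReal.one_ne_top hp)
    rw [ENNReal.ofReal_one] at h
    exact propext h.symm
  have hval : ∀ x, putValue P ℱ X r K x =
      m⁻¹ * ∫ p, max (Real.exp a - Real.exp x * J p) 0 ∂(κ.prod P) := by
    intro x
    rw [hX.putValue_eq hκ hM0, ENNReal.toReal_div, ← hm, div_eq_inv_mul, excess,
      ← integral_toReal]
    · congr 1
      refine integral_congr_ae ?_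
      filter_upwards [hE1] with p hp
      have hfin := ne_top_of_le_ne_top ENNReal.one_ne_top hp
      rw [← ENNReal.ofReal_toReal hM, ← ENNReal.ofReal_toReal hfin, ← hm,
        ← ENNReal.ofReal_mul hK.le, ← ENNReal.ofReal_mul (Real.exp_pos x).le,
        ← ENNReal.ofReal_sub _ (by positivity), ENNReal.toReal_ofReal', hea]
    · exact (measurable_const.sub (hE.const_mul _)).aemeasurable
    · refine Eventually.of_forall fun p => lt_of_le_of_lt tsub_le_self ?_
      exact ENNReal.mul_lt_top ENNReal.ofReal_lt_top hM.lt_top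
  have hd := (hasDerivWithinAt_integral_max hE.ennreal_toReal
    (Eventually.of_forall fun p => ENNReal.toReal_nonneg)
    (hE1.mono fun p hp => ENNReal.toReal_mono ENNReal.one_ne_top hp) a).const_mul m⁻¹
  rw [funext hval]
  refine hd.congr_deriv ?_
  rw [hatom, hint, hea]
  field_simp
  ring

end AKLevy
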